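/- arXiv:1407.8009 — 2 statements merged into one kernel-verified Lean document; each statement's English description precedes it below -/
import Mathlib

section
/- Let n ≥ 1, α > 0, and let μ = α∑_{i=1}^n δ_{x_i} and μ′ = α∑_{i=1}^n δ_{x′_i} be two measures each consisting of n atoms of the same mass α. Assume μ ≤_sto μ′, and let ν ∈ M satisfy μ ≤_{C,+} ν and μ′ ≤_{C,+} ν. Then the shadows satisfy S^ν(μ) ≤_sto S^ν(μ′). -/
open MeasureTheory Set Filter ProbabilityTheory

noncomputable section

/-- A function has at most linear growth. -/
def LinGrowth (φ : ℝ → ℝ) : Prop := ∃ C : ℝ, ∀ x : ℝ, |φ x| ≤ C * (1 + |x|)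

/-- Membership in `M`: finite positive Borel measure on `ℝ` with finite first moment. -/
def MemM (μ : Measure ℝ) : Prop := IsFiniteMeasure μ ∧ Integrable (fun x => x) μ

/-- Stochastic order `≤_sto`. -/
def leSto (μ ν : Measure ℝ) : Prop :=
  ∀ φ : ℝ → ℝ, LinGrowth φ → Monotone φ → ∫ x, φ x ∂μ ≤ ∫ x, φ x ∂ν

/-- Convex order `≤_C`. -/
def leC (μ ν : Measure ℝ) : Prop :=
  ∀ φ : ℝ → ℝ, LinGrowth φ → ConvexOn ℝ Set.univ φ → ∫ x, φ x ∂μ ≤ ∫ x, φ x ∂ν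

/-- Order `≤_{C,+}` (extended order). -/
def leCP (μ ν : Measure ℝ) : Prop :=
  ∀ φ : ℝ → ℝ, LinGrowth φ → ConvexOn ℝ Set.univ φ → (∀ x, 0 ≤ φ x) →
    ∫ x, φ x ∂μ ≤ ∫ x, φ x ∂ν

/-- Order `≤_{sto,+}`. -/
def leStoP (μ ν : Measure ℝ) : Prop :=
  ∀ φ : ℝ → ℝ, LinGrowth φ → Monotone φ → (∀ x, 0 ≤ φ x) →
    ∫ x, φ x ∂μ ≤ ∫ x, φ x ∂ν

/-- Order `≤_{C,sto}`. -/
def leCS (μ ν : Measure ℝ) : Prop :=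
  ∀ φ : ℝ → ℝ, LinGrowth φ → ConvexOn ℝ Set.univ φ → Monotone φ →
    ∫ x, φ x ∂μ ≤ ∫ x, φ x ∂ν

/-- Order `≤_{C,+,sto}`. -/
def leCPS (μ ν : Measure ℝ) : Prop :=
  ∀ φ : ℝ → ℝ, LinGrowth φ → ConvexOn ℝ Set.univ φ → (∀ x, 0 ≤ φ x) → Monotone φ →
    ∫ x, φ x ∂μ ≤ ∫ x, φ x ∂ν

/-- The Kantorovich distance. -/
def W (μ ν : Measure ℝ) : ℝ :=
  sSup {d : ℝ | ∃ f : ℝ → ℝ, LipschitzWith 1 f ∧ d = |∫ x, f x ∂μ - ∫ x, f x ∂ν|}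

/-- Quantile function `G_ν`. -/
def quantile (ν : Measure ℝ) (t : ℝ) : ℝ := sInf {x : ℝ | t ≤ (ν (Set.Iic x)).toReal}

/-- `IsShadow μ ν η` means `η = S^ν(μ)`, the shadow of `μ` in `ν`. -/
def IsShadow (μ ν η : Measure ℝ) : Prop :=
  leC μ η ∧ η ≤ ν ∧ ∀ η' : Measure ℝ, leC μ η' → η' ≤ ν → leC η η'

/-- `Top(μ,ν)`: pushforward of Lebesgue measure on `(0, m]` by `max (G_μ) (G_ν)`. -/
def TopMeas (μ ν : Measure ℝ) : Measure ℝ :=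
  Measure.map (fun t => max (quantile μ t) (quantile ν t))
    (volume.restrict (Set.Ioc (0:ℝ) (μ Set.univ).toReal))

/-- `Down(μ,ν)`: pushforward of Lebesgue measure on `(0, m]` by `min (G_μ) (G_ν)`. -/
def DownMeas (μ ν : Measure ℝ) : Measure ℝ :=
  Measure.map (fun t => min (quantile μ t) (quantile ν t))
    (volume.restrict (Set.Ioc (0:ℝ) (μ Set.univ).toReal))

/-- Support of a measure on a topological space. -/
def mSupport {α : Type*} [TopologicalSpace α] [MeasurableSpace α] (μ : Measure α) : Set α :=
  {x | ∀ U ∈ nhds x, μ U ≠ 0}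

/-- Positive part (Jordan decomposition) of the signed measure `η - μ`. -/
def posPartSub (η μ : Measure ℝ) [IsFiniteMeasure η] [IsFiniteMeasure μ] : Measure ℝ :=
  (η.toSignedMeasure - μ.toSignedMeasure).toJordanDecomposition.posPart

/-- `π` is a martingale coupling of `μ` and `ν`. -/
def IsMartCoupling (π : Measure (ℝ × ℝ)) (μ ν : Measure ℝ) : Prop :=
  IsProbabilityMeasure π ∧ π.fst = μ ∧ π.snd = ν ∧
    ∀ f : ℝ → ℝ, Continuous f → (∃ C : ℝ, ∀ x, |f x| ≤ C) →
      ∫ p : ℝ × ℝ, f p.1 * (p.2 - p.1) ∂π = 0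

/-- A coupling is left-monotone. -/
def LeftMonotone (π : Measure (ℝ × ℝ)) : Prop :=
  ∃ Γ : Set (ℝ × ℝ), MeasurableSet Γ ∧ π Γ = 1 ∧
    ∀ x ym yp x' y' : ℝ, (x, ym) ∈ Γ → (x, yp) ∈ Γ → (x', y') ∈ Γ →
      x < x' → ym < yp → y' ∉ Set.Ioo ym yp

/-- The set `A` of points `x` with `π((-∞,x) × (x,∞)) = 0`. -/
def jumpSet (π : Measure (ℝ × ℝ)) : Set ℝ := {x | π (Set.Iio x ×ˢ Set.Ioi x) = 0}

/-- The set `A⁻` of points of `A` isolated on the right in `A`. -/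
def jumpSetMinus (π : Measure (ℝ × ℝ)) : Set ℝ :=
  {x ∈ jumpSet π | ∃ ε > 0, Set.Ioo x (x + ε) ∩ jumpSet π = ∅}

/-- Normalised fiber measure `π_x`. -/
def fiberMeasure (π : Measure (ℝ × ℝ)) (x : ℝ) : Measure ℝ :=
  (π.fst {x})⁻¹ • Measure.snd (π.restrict ({x} ×ˢ Set.univ))

/-- The reduced support `spt* π`. -/
def sptStar (π : Measure (ℝ × ℝ)) : Set (ℝ × ℝ) :=
  (mSupport π \ (jumpSetMinus π ×ˢ (Set.univ : Set ℝ))) ∪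
    ⋃ x ∈ {x : ℝ | 0 < π.fst {x}}, {x} ×ˢ mSupport (fiberMeasure π x)

/-- The potential `k ↦ ∫ (k - y)⁺ dμ(y)`. -/
def put (μ : Measure ℝ) (k : ℝ) : ℝ := ∫ y, max (k - y) 0 ∂μ

section Potential

variable {μ ν : Measure ℝ} [IsFiniteMeasure μ] [IsFiniteMeasure ν]

lemma integrable_hinge (hμ : Integrable (fun y => y) μ) (k : ℝ) :
    Integrable (fun y => max (k - y) 0) μ :=
  ((integrable_const k).sub hμ).pos_part

lemma put_sub_le (hμ : Integrable (fun y => y) μ) {k l : ℝ} (_h : l ≤ k) :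
    put μ k - put μ l ≤ (k - l) * μ.real (Iic k) := by
  unfold put
  rw [← integral_sub (integrable_hinge hμ k) (integrable_hinge hμ l)]
  have : (k - l) * μ.real (Iic k) = ∫ y, (Iic k).indicator (fun _ => k - l) y ∂μ := by
    rw [integral_indicator_const _ measurableSet_Iic, smul_eq_mul, mul_comm]
  rw [this]
  refine integral_mono ((integrable_hinge hμ k).sub (integrable_hinge hμ l))
    ((integrable_const _).indicator measurableSet_Iic) fun y => ?_
  by_cases hy : y ≤ k
  · simp only [indicator, mem_Iic, hy, if_true]
    have h1 : max (k - y) 0 = k - y := max_eq_left (by linarith)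
    have h2 := le_max_left (l - y) 0
    linarith
  · simp only [indicator, mem_Iic, hy, if_false]
    have h1 : max (k - y) 0 = 0 := max_eq_right (by linarith)
    have h2 := le_max_right (l - y) 0
    linarith

lemma le_put_sub (hμ : Integrable (fun y => y) μ) {k l : ℝ} (_h : l ≤ k) :
    (k - l) * μ.real (Iic l) ≤ put μ k - put μ l := by
  unfold put
  rw [← integral_sub (integrable_hinge hμ k) (integrable_hinge hμ l)]
  have : (k - l) * μ.real (Iic l) = ∫ y, (Iic l).indicator (fun _ => k - l) y ∂μ := by
    rw [integral_indicator_const _ measurableSet_Iic, smul_eq_mul, mul_comm]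
  rw [this]
  refine integral_mono ((integrable_const _).indicator measurableSet_Iic)
    ((integrable_hinge hμ k).sub (integrable_hinge hμ l)) fun y => ?_
  by_cases hy : y ≤ l
  · simp only [indicator, mem_Iic, hy, if_true]
    have h1 : max (l - y) 0 = l - y := max_eq_left (by linarith)
    have h2 := le_max_left (k - y) 0
    linarith
  · simp only [indicator, mem_Iic, hy, if_false]
    have h1 : max (l - y) 0 = 0 := max_eq_right (by linarith)
    have h2 := le_max_right (k - y) 0
    linarith

lemma put_supporting_line (hμ : Integrable (fun y => y) μ) (k y : ℝ) :
    put μ k + μ.real (Iic k) * (y - k) ≤ put μ y := by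
  rcases le_total k y with h | h
  · linarith [le_put_sub hμ h]
  · linarith [put_sub_le hμ h]

lemma continuous_put (hμ : Integrable (fun y => y) μ) : Continuous (put μ) := by
  refine (LipschitzWith.of_le_add_mul ⟨μ.real univ, measureReal_nonneg⟩ fun x y => ?_).continuous
  change put μ x ≤ put μ y + μ.real univ * dist x y
  have h := put_supporting_line hμ x y
  have h1 : μ.real (Iic x) ≤ μ.real univ := measureReal_mono (subset_univ _)
  have h2 : μ.real (Iic x) * (x - y) ≤ μ.real univ * |x - y| :=
    (mul_le_mul_of_nonneg_left (le_abs_self _) measureReal_nonneg).trans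
      (mul_le_mul_of_nonneg_right h1 (abs_nonneg _))
  rw [Real.dist_eq]
  linarith

lemma put_eq_call (hμ : Integrable (fun y => y) μ) (k : ℝ) :
    put μ k = μ.real univ * k - ∫ y, y ∂μ + ∫ y, max (y - k) 0 ∂μ := by
  have h1 : Integrable (fun y => max (y - k) 0) μ := (hμ.sub (integrable_const k)).pos_part
  have h2 : put μ k = ∫ y, ((k - y) + max (y - k) 0) ∂μ := by
    refine integral_congr_ae (Eventually.of_forall fun y => ?_)
    rcases le_total k y with h | h
    · simp [max_eq_right (sub_nonpos.2 h), max_eq_left (sub_nonneg.2 h)]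
    · simp [max_eq_right (sub_nonpos.2 h), max_eq_left (sub_nonneg.2 h)]
  have h3 : Integrable (fun y => k - y) μ := (integrable_const k).sub hμ
  rw [h2, integral_add h3 h1, integral_sub (integrable_const k) hμ]
  simp

lemma tendsto_put_atBot (hμ : Integrable (fun y => y) μ) :
    Tendsto (put μ) atBot (nhds 0) := by
  rw [show nhds (0 : ℝ) = nhds (∫ _, (0 : ℝ) ∂μ) by simp]
  refine tendsto_integral_filter_of_dominated_convergence (fun y => |y|)
    (Eventually.of_forall fun k => (integrable_hinge hμ k).aestronglyMeasurable) ?_ hμ.abs ?_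
  · filter_upwards [eventually_le_atBot (0 : ℝ)] with k hk
    refine Eventually.of_forall fun y => ?_
    rw [Real.norm_eq_abs, abs_of_nonneg (le_max_right _ _)]
    exact max_le (by linarith [neg_abs_le y]) (abs_nonneg y)
  · refine Eventually.of_forall fun y => tendsto_const_nhds.congr' ?_
    filter_upwards [eventually_le_atBot y] with k hk
    exact (max_eq_right (by linarith)).symm

lemma tendsto_call_atTop (hμ : Integrable (fun y => y) μ) :
    Tendsto (fun k => ∫ y, max (y - k) 0 ∂μ) atTop (nhds 0) := by
  rw [show nhds (0 : ℝ) = nhds (∫ _, (0 : ℝ) ∂μ) by simp]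
  refine tendsto_integral_filter_of_dominated_convergence (fun y => |y|)
    (Eventually.of_forall fun k =>
      (hμ.sub (integrable_const k)).pos_part.aestronglyMeasurable) ?_ hμ.abs ?_
  · filter_upwards [eventually_ge_atTop (0 : ℝ)] with k hk
    refine Eventually.of_forall fun y => ?_
    rw [Real.norm_eq_abs, abs_of_nonneg (le_max_right _ _)]
    exact max_le (by linarith [le_abs_self y]) (abs_nonneg y)
  · refine Eventually.of_forall fun y => tendsto_const_nhds.congr' ?_
    filter_upwards [eventually_ge_atTop y] with k hk
    exact (max_eq_right (by linarith)).symm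

lemma real_Iic_eq_integral (μ : Measure ℝ) (x : ℝ) :
    μ.real (Iic x) = ∫ y, (Iic x).indicator (fun _ => (1 : ℝ)) y ∂μ := by
  rw [integral_indicator_const _ measurableSet_Iic, smul_eq_mul, mul_one]

lemma continuousWithinAt_real_Iic (μ : Measure ℝ) [IsFiniteMeasure μ] (x : ℝ) :
    ContinuousWithinAt (fun x => μ.real (Iic x)) (Ici x) x := by
  simp only [ContinuousWithinAt, real_Iic_eq_integral]
  refine tendsto_integral_filter_of_dominated_convergence (fun _ => 1)
    (Eventually.of_forall fun k =>
      (measurable_const.indicator measurableSet_Iic).aestronglyMeasurable) ?_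
    (integrable_const _) ?_
  · refine Eventually.of_forall fun k => Eventually.of_forall fun y => ?_
    by_cases hy : y ≤ k <;> simp [indicator, hy]
  · refine Eventually.of_forall fun y => tendsto_const_nhds.congr' ?_
    rcases le_or_gt y x with hy | hy
    · filter_upwards [self_mem_nhdsWithin] with z hz
      simp [indicator, hy, hy.trans hz]
    · filter_upwards [mem_nhdsWithin_of_mem_nhds (Iio_mem_nhds hy)] with z hz
      simp [indicator, not_le.2 hy, not_le.2 (mem_Iio.1 hz)]

lemma tendsto_real_Iic_atBot (μ : Measure ℝ) [IsFiniteMeasure μ] :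
    Tendsto (fun x => μ.real (Iic x)) atBot (nhds 0) := by
  simp only [real_Iic_eq_integral]
  rw [show nhds (0 : ℝ) = nhds (∫ _, (0 : ℝ) ∂μ) by simp]
  refine tendsto_integral_filter_of_dominated_convergence (fun _ => 1)
    (Eventually.of_forall fun k =>
      (measurable_const.indicator measurableSet_Iic).aestronglyMeasurable) ?_
    (integrable_const _) ?_
  · refine Eventually.of_forall fun k => Eventually.of_forall fun y => ?_
    by_cases hy : y ≤ k <;> simp [indicator, hy]
  · refine Eventually.of_forall fun y => tendsto_const_nhds.congr' ?_
    filter_upwards [eventually_lt_atBot y] with z hz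
    simp [indicator, not_le.2 hz]

lemma real_Iic_le_of_put_eq (hμ : Integrable (fun y => y) μ) (hν : Integrable (fun y => y) ν)
    (h : put μ = put ν) (x : ℝ) : μ.real (Iic x) ≤ ν.real (Iic x) := by
  have hc := (continuousWithinAt_real_Iic ν x).mono_left (nhdsWithin_mono x Ioi_subset_Ici_self)
  refine ge_of_tendsto hc ?_
  filter_upwards [self_mem_nhdsWithin] with y hy
  have hy' : x < y := hy
  have h1 := le_put_sub hμ hy'.le
  have h2 := put_sub_le hν hy'.le
  rw [h] at h1
  exact le_of_mul_le_mul_left (h1.trans h2) (by linarith)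

lemma eq_of_put_eq (hμ : Integrable (fun y => y) μ) (hν : Integrable (fun y => y) ν)
    (h : put μ = put ν) : μ = ν := by
  refine Measure.ext_of_Iic _ _ fun x => ?_
  have := le_antisymm (real_Iic_le_of_put_eq hμ hν h x) (real_Iic_le_of_put_eq hν hμ h.symm x)
  exact (measureReal_eq_measureReal_iff).1 this

end Potential

lemma exists_add_eq_of_real_Iic {θ ν : Measure ℝ} [IsFiniteMeasure θ] [IsFiniteMeasure ν]
    (h : ∀ a b, a ≤ b →
      θ.real (Iic b) - θ.real (Iic a) ≤ ν.real (Iic b) - ν.real (Iic a)) :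
    ∃ ρ : Measure ℝ, ρ + θ = ν := by
  let f : StieltjesFunction ℝ :=
    { toFun := fun x => ν.real (Iic x) - θ.real (Iic x)
      mono' := fun a b hab => by
        have := h a b hab
        dsimp only
        linarith
      right_continuous' := fun x =>
        (continuousWithinAt_real_Iic ν x).sub (continuousWithinAt_real_Iic θ x) }
  have hf : ∀ x, f x = ν.real (Iic x) - θ.real (Iic x) := fun _ => rfl
  have hlim : Tendsto f atBot (nhds 0) := by
    simpa using (tendsto_real_Iic_atBot ν).sub (tendsto_real_Iic_atBot θ)
  have hf0 : ∀ x, 0 ≤ f x := fun x => f.mono.le_of_tendsto hlim x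
  refine ⟨f.measure, (Measure.ext_of_Iic _ _ fun x => ?_).symm⟩
  rw [Measure.add_apply, f.measure_Iic hlim, sub_zero, ← ofReal_measureReal (μ := θ),
    ← ENNReal.ofReal_add (hf0 x) measureReal_nonneg, ← ofReal_measureReal (μ := ν), hf]
  congr 1
  ring

lemma convexOn_supporting_line {ψ : ℝ → ℝ} (hψ : ConvexOn ℝ univ ψ) (y x : ℝ) :
    ψ y + derivWithin ψ (Ioi y) y * (x - y) ≤ ψ x := by
  have hint : ∀ z : ℝ, z ∈ interior (univ : Set ℝ) := fun z => by simp
  rcases lt_trichotomy y x with h | h | h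
  · have := hψ.rightDeriv_le_slope_of_mem_interior (hint y) (mem_univ x) h
    rw [slope_def_field, le_div_iff₀ (by linarith)] at this
    linarith
  · simp [h]
  · have h1 := hψ.slope_le_leftDeriv_of_mem_interior (mem_univ x) (hint y) h
    have h2 := hψ.leftDeriv_le_rightDeriv_of_mem_interior (hint y)
    have h3 := h1.trans h2
    rw [slope_def_field, div_le_iff₀ (by linarith)] at h3
    linarith

/-- A convex function can be interpolated from below on a finite set by an affine function plus
finitely many functions of the form `(c x + d)⁺` with `0 ≤ c`. -/
lemma exists_hinge_interpolation {Q : (ℝ → ℝ) → Prop}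
    (haff : ∀ a b : ℝ, Q fun x => a + b * x)
    (hadd : ∀ (f : ℝ → ℝ) (c d : ℝ), Q f → 0 ≤ c → Q fun x => f x + max (c * x + d) 0)
    {ψ : ℝ → ℝ} (hψ : ConvexOn ℝ univ ψ) (S : Finset ℝ) :
    ∃ f, Q f ∧ (∀ x ∈ S, f x = ψ x) ∧ ∀ x, f x ≤ ψ x := by
  set s : ℝ → ℝ := fun y => derivWithin ψ (Ioi y) y with hs
  have hsup : ∀ y x, ψ y + s y * (x - y) ≤ ψ x := convexOn_supporting_line hψ
  suffices H : ∃ f, Q f ∧ (∀ x ∈ S, f x = ψ x) ∧ (∀ x, f x ≤ ψ x) ∧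
      ∀ y ∈ S, (∀ z ∈ S, z ≤ y) → ∀ x, y ≤ x → f x = ψ y + s y * (x - y) by
    obtain ⟨f, h1, h2, h3, -⟩ := H
    exact ⟨f, h1, h2, h3⟩
  induction S using Finset.induction_on_max with
  | empty =>
    refine ⟨_, haff (ψ 0) (s 0), by simp, fun x => ?_, by simp⟩
    simpa using hsup 0 x
  | insert a S ha ih =>
    have hmax : ∀ y ∈ insert a S, (∀ z ∈ insert a S, z ≤ y) → y = a := by
      intro y hy hz
      rcases Finset.mem_insert.1 hy with rfl | hy
      · rfl
      · exact absurd (ha y hy) (not_lt.2 (hz a (Finset.mem_insert_self _ _)))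
    rcases S.eq_empty_or_nonempty with rfl | hne
    · refine ⟨_, haff (ψ a - s a * a) (s a), ?_, fun x => ?_, ?_⟩
      · intro x hx
        obtain rfl : x = a := by simpa using hx
        ring
      · linarith [hsup a x]
      · intro y hy hz x _
        rw [hmax y hy hz]
        ring
    · obtain ⟨f, hQ, hS, hle, hlast⟩ := ih
      set y := S.max' hne with hy
      have hyS : y ∈ S := S.max'_mem hne
      have hya : y < a := ha y hyS
      have hf := hlast y hyS fun z hz => S.le_max' z hz
      have h1 := hsup y a
      have h2 := hsup a y
      have hslope : 0 ≤ s a - s y := by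
        by_contra hcon
        have := mul_pos_of_neg_of_neg (not_le.1 hcon) (sub_neg.2 hya)
        nlinarith
      set c := s a - s y with hc
      set d := ψ a - s a * a - (ψ y - s y * y) with hd
      have hright : ∀ x, y ≤ x → f x + max (c * x + d) 0
          = max (ψ a + s a * (x - a)) (ψ y + s y * (x - y)) := by
        intro x hx
        rw [hf x hx, ← max_add_add_left]
        congr 1
        · rw [hc, hd]; ring
        · ring
      have hleft : ∀ x, x ≤ y → max (c * x + d) 0 = 0 := by
        intro x hx
        refine max_eq_right ?_
        have : c * x ≤ c * y := mul_le_mul_of_nonneg_left hx hslope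
        have : c * y + d = ψ a + s a * (y - a) - ψ y := by rw [hc, hd]; ring
        linarith
      have hbeyond : ∀ x, a ≤ x → f x + max (c * x + d) 0 = ψ a + s a * (x - a) := by
        intro x hx
        rw [hright x (hya.le.trans hx)]
        refine max_eq_left ?_
        have : c * a ≤ c * x := mul_le_mul_of_nonneg_left hx hslope
        have h3 : c * a + d = ψ a - (ψ y + s y * (a - y)) := by rw [hc, hd]; ring
        have h4 : c * x + d = ψ a + s a * (x - a) - (ψ y + s y * (x - y)) := by
          rw [hc, hd]; ring
        linarith
      refine ⟨_, hadd f c d hQ hslope, ?_, ?_, ?_⟩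
      · intro x hx
        rcases Finset.mem_insert.1 hx with rfl | hx
        · rw [hbeyond x le_rfl]; ring
        · rw [hleft x (S.le_max' x hx), hS x hx, add_zero]
      · intro x
        rcases le_total x y with hx | hx
        · rw [hleft x hx, add_zero]; exact hle x
        · rw [hright x hx]; exact max_le (hsup a x) (hsup y x)
      · intro z hz hzmax x hx
        rw [hmax z hz hzmax] at hx ⊢
        exact hbeyond x hx

lemma integrable_of_linGrowth {μ : Measure ℝ} [IsFiniteMeasure μ]
    (hμ : Integrable (fun y => y) μ) {φ : ℝ → ℝ} (hφ : LinGrowth φ) (hm : Measurable φ) :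
    Integrable φ μ := by
  obtain ⟨C, hC⟩ := hφ
  exact (((integrable_const (1 : ℝ)).add hμ.abs).const_mul C).mono' hm.aestronglyMeasurable
    (Eventually.of_forall hC)

lemma measurable_of_convexOn {φ : ℝ → ℝ} (hφ : ConvexOn ℝ univ φ) : Measurable φ :=
  (continuousOn_univ.1 (hφ.continuousOn isOpen_univ)).measurable

lemma linGrowth_affine (a b : ℝ) : LinGrowth fun x => a + b * x := by
  refine ⟨|a| + |b|, fun x => ?_⟩
  have h := abs_add_le a (b * x)
  rw [abs_mul] at h
  nlinarith [abs_nonneg a, abs_nonneg b, abs_nonneg x,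
    mul_nonneg (abs_nonneg a) (abs_nonneg x)]

lemma linGrowth_affine_pos (a b : ℝ) : LinGrowth fun x => max (a + b * x) 0 := by
  obtain ⟨C, hC⟩ := linGrowth_affine a b
  refine ⟨C, fun x => le_trans ?_ (hC x)⟩
  rw [abs_of_nonneg (le_max_right _ _)]
  exact max_le (le_abs_self _) (abs_nonneg _)

lemma convexOn_affine (a b : ℝ) : ConvexOn ℝ univ fun x : ℝ => a + b * x := by
  refine ⟨convex_univ, fun x _ y _ s t _ _ hst => le_of_eq ?_⟩
  simp only [smul_eq_mul]
  linear_combination (-a) * hst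

lemma convexOn_affine_pos (a b : ℝ) : ConvexOn ℝ univ fun x : ℝ => max (a + b * x) 0 :=
  (convexOn_affine a b).sup (convexOn_const 0 convex_univ)

/-- A finite combination of atoms is dominated in convex order as soon as mass and mean agree and
the potentials are ordered. -/
lemma leC_of_put_le {ι : Type*} [Fintype ι] {α : ℝ} (x : ι → ℝ) {μ η : Measure ℝ}
    [IsFiniteMeasure μ] [IsFiniteMeasure η]
    (hdef : μ = ENNReal.ofReal α • ∑ i, Measure.dirac (x i))
    (hμ : Integrable (fun y => y) μ) (hη : Integrable (fun y => y) η)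
    (hmass : μ.real univ = η.real univ) (hmean : ∫ y, y ∂μ = ∫ y, y ∂η)
    (hput : ∀ k, put μ k ≤ put η k) : leC μ η := by
  intro φ hφ hconv
  let Q : (ℝ → ℝ) → Prop := fun f => Integrable f μ ∧ Integrable f η ∧ ∫ y, f y ∂μ ≤ ∫ y, f y ∂η
  have iaff : ∀ (ρ : Measure ℝ) [IsFiniteMeasure ρ], Integrable (fun y => y) ρ → ∀ a b : ℝ,
      Integrable (fun y => a + b * y) ρ ∧
        ∫ y, (a + b * y) ∂ρ = ρ.real univ * a + b * ∫ y, y ∂ρ := by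
    intro ρ _ hρ a b
    refine ⟨(integrable_const a).add (hρ.const_mul b), ?_⟩
    rw [integral_add (integrable_const a) (hρ.const_mul b), integral_const, integral_const_mul,
      smul_eq_mul]
  have ihinge : ∀ (ρ : Measure ℝ) [IsFiniteMeasure ρ], Integrable (fun y => y) ρ →
      ∀ c d : ℝ, 0 < c → Integrable (fun y => max (c * y + d) 0) ρ ∧
        ∫ y, max (c * y + d) 0 ∂ρ
          = ρ.real univ * d + c * ∫ y, y ∂ρ + c * put ρ (-d / c) := by
    intro ρ _ hρ c d hc
    have h : ∀ y : ℝ, max (c * y + d) 0 = (d + c * y) + c * max (-d / c - y) 0 := by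
      intro y
      rw [mul_max_of_nonneg _ _ hc.le, ← max_add_add_left, max_comm]
      congr 1
      · field_simp; ring
      · ring
    have h1 := (iaff ρ hρ d c).1
    have h2 := (integrable_hinge hρ (-d / c)).const_mul c
    simp_rw [h]
    refine ⟨h1.add h2, ?_⟩
    rw [integral_add h1 h2, (iaff ρ hρ d c).2, integral_const_mul]
    rfl
  obtain ⟨f, hQ, hS, hle⟩ := exists_hinge_interpolation (Q := Q)
    (fun a b => ⟨(iaff μ hμ a b).1, (iaff η hη a b).1, by
      rw [(iaff μ hμ a b).2, (iaff η hη a b).2, hmass, hmean]⟩)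
    (by
      rintro f c d ⟨h1, h2, h3⟩ hc
      have key : Integrable (fun y => max (c * y + d) 0) μ ∧
          Integrable (fun y => max (c * y + d) 0) η ∧
          ∫ y, max (c * y + d) 0 ∂μ ≤ ∫ y, max (c * y + d) 0 ∂η := by
        rcases hc.eq_or_lt with rfl | hc
        · simp [hmass]
        · refine ⟨(ihinge μ hμ c d hc).1, (ihinge η hη c d hc).1, ?_⟩
          rw [(ihinge μ hμ c d hc).2, (ihinge η hη c d hc).2, hmass, hmean]
          have := mul_le_mul_of_nonneg_left (hput (-d / c)) hc.le
          linarith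
      refine ⟨h1.add key.1, h2.add key.2.1, ?_⟩
      rw [integral_add h1 key.1, integral_add h2 key.2.1]
      exact add_le_add h3 key.2.2)
    hconv (Finset.univ.image x)
  have heq : ∫ y, φ y ∂μ = ∫ y, f y ∂μ := by
    refine integral_congr_ae ?_
    subst hdef
    refine Measure.ae_smul_measure ?_ _
    rw [← Measure.sum_fintype, Measure.ae_sum_eq]
    refine eventually_iSup.2 fun i => ?_
    rw [ae_dirac_eq]
    exact (hS (x i) (Finset.mem_image_of_mem _ (Finset.mem_univ i))).symm
  rw [heq]
  exact hQ.2.2.trans (integral_mono hQ.2.1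
    (integrable_of_linGrowth hη hφ (measurable_of_convexOn hconv)) hle)

section Legendre

/-- The asymptotic behaviour of a difference of two potentials, with gap `m` between the masses
and gap `β` between the means. -/
structure IsPotentialGap (g : ℝ → ℝ) (m β : ℝ) : Prop where
  cont : Continuous g
  nonneg : ∀ k, 0 ≤ g k
  le : ∀ k, m * k - β ≤ g k
  tendsto_atBot : Tendsto g atBot (nhds 0)
  tendsto_atTop : Tendsto (fun k => m * k - g k) atTop (nhds β)
  pos : 0 < m

/-- The Legendre transform. -/
def legendre (g : ℝ → ℝ) (p : ℝ) : ℝ := ⨆ k, (p * k - g k)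

/-- `G p` maximises `k ↦ p k - g k` for every `p ∈ (0, m)`. -/
def IsArgmax (g : ℝ → ℝ) (m : ℝ) (G : ℝ → ℝ) : Prop :=
  ∀ p ∈ Ioo 0 m, ∀ k, p * k - g k ≤ p * G p - g (G p)

variable {g G : ℝ → ℝ} {m β : ℝ}

lemma IsPotentialGap.sub_le (hg : IsPotentialGap g m β) {p : ℝ} (hp : p ∈ Icc 0 m) (k : ℝ) :
    p * k - g k ≤ p / m * β := by
  have hm := hg.pos
  have h1 : 0 ≤ p / m := div_nonneg hp.1 hm.le
  have h2 : p / m ≤ 1 := (div_le_one hm).2 hp.2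
  have h3 : p / m * (m * k - β) ≤ p / m * g k := mul_le_mul_of_nonneg_left (hg.le k) h1
  have h4 : p / m * g k ≤ g k := mul_le_of_le_one_left (hg.nonneg k) h2
  have h5 : p / m * (m * k - β) = p * k - p / m * β := by field_simp
  linarith

lemma IsPotentialGap.le_legendre (hg : IsPotentialGap g m β) {p : ℝ} (hp : p ∈ Icc 0 m) (k : ℝ) :
    p * k - g k ≤ legendre g p :=
  le_ciSup (f := fun k => p * k - g k) ⟨p / m * β, by rintro _ ⟨k, rfl⟩; exact hg.sub_le hp k⟩ k

lemma IsPotentialGap.legendre_le (hg : IsPotentialGap g m β) {p : ℝ} (hp : p ∈ Icc 0 m) :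
    legendre g p ≤ p / m * β :=
  ciSup_le (hg.sub_le hp)

lemma IsPotentialGap.legendre_zero (hg : IsPotentialGap g m β) : legendre g 0 = 0 := by
  have h0 : (0 : ℝ) ∈ Icc 0 m := ⟨le_rfl, hg.pos.le⟩
  refine le_antisymm (by simpa using hg.legendre_le h0) ?_
  have : Tendsto (fun k => -g k) atBot (nhds 0) := by simpa using hg.tendsto_atBot.neg
  exact le_of_tendsto' this fun k => by simpa using hg.le_legendre h0 k

lemma IsPotentialGap.legendre_right (hg : IsPotentialGap g m β) : legendre g m = β := by
  have h0 : m ∈ Icc 0 m := ⟨hg.pos.le, le_rfl⟩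
  refine le_antisymm (by simpa [hg.pos.ne'] using hg.legendre_le h0) ?_
  exact le_of_tendsto' hg.tendsto_atTop fun k => hg.le_legendre h0 k

lemma IsPotentialGap.exists_isArgmax (hg : IsPotentialGap g m β) : ∃ G, IsArgmax g m G := by
  have : ∀ p ∈ Ioo 0 m, ∃ x, ∀ k, p * k - g k ≤ p * x - g x := by
    intro p hp
    have hc : Continuous fun k => p * k - g k := (continuous_const_mul p).sub hg.cont
    refine hc.exists_forall_ge ?_
    rw [cocompact_eq_atBot_atTop]
    refine Tendsto.sup ?_ ?_
    · refine tendsto_atBot_mono (f := fun k => p * k) (fun k => ?_)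
        (tendsto_id.const_mul_atBot hp.1)
      have := hg.nonneg k
      linarith
    · refine tendsto_atBot_mono (f := fun k => (p - m) * k + β) (fun k => ?_)
        (tendsto_atBot_add_const_right _ _ (tendsto_id.const_mul_atTop_of_neg (sub_neg.2 hp.2)))
      have := hg.le k
      linarith
  choose! G hG using this
  exact ⟨G, hG⟩

lemma IsArgmax.monotoneOn (hG : IsArgmax g m G) : MonotoneOn G (Ioo 0 m) := by
  intro p hp q hq hpq
  rcases hpq.eq_or_lt with rfl | hpq
  · rfl
  have h1 := hG p hp (G q)
  have h2 := hG q hq (G p)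
  by_contra! hcon
  nlinarith [mul_pos (sub_pos.2 hpq) (sub_pos.2 hcon)]

lemma IsArgmax.legendre_eq (hG : IsArgmax g m G) (hg : IsPotentialGap g m β) {p : ℝ}
    (hp : p ∈ Ioo 0 m) : legendre g p = p * G p - g (G p) :=
  le_antisymm (ciSup_le (hG p hp)) (hg.le_legendre (Ioo_subset_Icc_self hp) _)

lemma IsArgmax.subgradient (hG : IsArgmax g m G) (hg : IsPotentialGap g m β) {p q : ℝ}
    (hp : p ∈ Ioo 0 m) (hq : q ∈ Icc 0 m) :
    legendre g p + (q - p) * G p ≤ legendre g q := by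
  have := hg.le_legendre hq (G p)
  rw [hG.legendre_eq hg hp]
  linarith

lemma IsArgmax.convexOn_legendre (hG : IsArgmax g m G) (hg : IsPotentialGap g m β) :
    ConvexOn ℝ (Ioo 0 m) (legendre g) := by
  refine ⟨convex_Ioo _ _, fun x hx y hy a b ha hb hab => ?_⟩
  have hz := convex_Ioo 0 m hx hy ha hb hab
  have h1 := mul_le_mul_of_nonneg_left (hG.subgradient hg hz (Ioo_subset_Icc_self hx)) ha
  have h2 := mul_le_mul_of_nonneg_left (hG.subgradient hg hz (Ioo_subset_Icc_self hy)) hb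
  simp only [smul_eq_mul] at *
  obtain rfl : b = 1 - a := by linarith
  linarith

lemma IsArgmax.continuousOn_legendre (hG : IsArgmax g m G) (hg : IsPotentialGap g m β) :
    ContinuousOn (legendre g) (Icc 0 m) := by
  have hend : ∀ p ∈ Icc 0 m, legendre g p = p / m * β →
      ContinuousWithinAt (legendre g) (Icc 0 m) p := by
    intro p hp hval
    refine tendsto_order.2 ⟨fun a ha => ?_, fun b hb => ?_⟩
    · obtain ⟨k, hk⟩ := exists_lt_of_lt_ciSup ha
      have hc : ContinuousWithinAt (fun q => q * k - g k) (Icc 0 m) p := by fun_prop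
      filter_upwards [hc.eventually_const_lt hk, self_mem_nhdsWithin] with q hq hq'
      exact hq.trans_le (hg.le_legendre hq' k)
    · rw [hval] at hb
      have hc : ContinuousWithinAt (fun q => q / m * β) (Icc 0 m) p := by fun_prop
      filter_upwards [hc.eventually_lt_const hb, self_mem_nhdsWithin] with q hq hq'
      exact (hg.legendre_le hq').trans_lt hq
  intro p hp
  rcases hp.1.eq_or_lt with rfl | h0
  · exact hend 0 hp (by simp [hg.legendre_zero])
  rcases hp.2.eq_or_lt with rfl | hm
  · exact hend _ hp (by simp [hg.legendre_right, hg.pos.ne'])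
  exact (((hG.convexOn_legendre hg).continuousOn isOpen_Ioo).continuousAt
    (Ioo_mem_nhds h0 hm)).continuousWithinAt

lemma IsArgmax.hasDerivAt_legendre (hG : IsArgmax g m G) (hg : IsPotentialGap g m β) {p : ℝ}
    (hp : p ∈ Ioo 0 m) (hc : ContinuousAt G p) : HasDerivAt (legendre g) (G p) p := by
  rw [hasDerivAt_iff_isLittleO, Asymptotics.isLittleO_iff]
  intro c hcpos
  filter_upwards [Metric.continuousAt_iff'.1 hc c hcpos, Ioo_mem_nhds hp.1 hp.2] with q hq hq'
  have h1 := hG.subgradient hg hp (Ioo_subset_Icc_self hq')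
  have h2 := hG.subgradient hg hq' (Ioo_subset_Icc_self hp)
  rw [Real.dist_eq] at hq
  rw [Real.norm_eq_abs, Real.norm_eq_abs, smul_eq_mul, abs_of_nonneg (by linarith)]
  calc legendre g q - legendre g p - (q - p) * G p ≤ (q - p) * (G q - G p) := by linarith
    _ ≤ |(q - p) * (G q - G p)| := le_abs_self _
    _ = |G q - G p| * |q - p| := by rw [abs_mul, mul_comm]
    _ ≤ c * |q - p| := mul_le_mul_of_nonneg_right hq.le (abs_nonneg _)

lemma IsArgmax.countable_not_continuousAt (hG : IsArgmax g m G) :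
    {p ∈ Ioo 0 m | ¬ ContinuousAt G p}.Countable := by
  refine hG.monotoneOn.countable_not_continuousWithinAt.mono ?_
  intro p hp
  refine ⟨hp.1, fun hcon => ?_⟩
  exact hp.2 (hcon.continuousAt (Ioo_mem_nhds hp.1.1 hp.1.2))

lemma intervalIntegrable_of_Ioo {f : ℝ → ℝ} (hf : IntegrableOn f (Ioo 0 m)) {a b : ℝ}
    (ha : 0 ≤ a) (hab : a ≤ b) (hb : b ≤ m) : IntervalIntegrable f volume a b :=
  (intervalIntegrable_iff_integrableOn_Ioo_of_le hab).2 (hf.mono_set (Ioo_subset_Ioo ha hb))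

lemma IsArgmax.integral_eq (hG : IsArgmax g m G) (hg : IsPotentialGap g m β)
    (hi : IntegrableOn G (Ioo 0 m)) {p : ℝ} (hp : p ∈ Icc 0 m) :
    ∫ t in (0 : ℝ)..p, G t = legendre g p := by
  rw [MeasureTheory.integral_eq_of_hasDerivAt_off_countable_of_le (legendre g) G hp.1
    hG.countable_not_continuousAt ((hG.continuousOn_legendre hg).mono (Icc_subset_Icc_right hp.2))
    ?_ (intervalIntegrable_of_Ioo hi le_rfl hp.1 hp.2), hg.legendre_zero, sub_zero]
  intro t ht
  have ht' : t ∈ Ioo 0 m := Ioo_subset_Ioo_right hp.2 ht.1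
  refine hG.hasDerivAt_legendre hg ht' ?_
  by_contra hcon
  exact ht.2 ⟨ht', hcon⟩

lemma IsArgmax.integral_hinge_le (hG : IsArgmax g m G) (hg : IsPotentialGap g m β)
    (hi : IntegrableOn G (Ioo 0 m)) (k : ℝ) :
    ∫ p in (0 : ℝ)..m, max (k - G p) 0 ≤ g k := by
  set A : Set ℝ := insert 0 {p ∈ Ioo 0 m | G p ≤ k} with hA
  have hAm : ∀ p ∈ A, p ≤ m := by
    rintro p (rfl | hp)
    · exact hg.pos.le
    · exact hp.1.2.le
  have hbdd : BddAbove A := ⟨m, hAm⟩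
  set q := sSup A with hq
  have hq0 : 0 ≤ q := le_csSup hbdd (mem_insert _ _)
  have hqm : q ≤ m := csSup_le ⟨0, mem_insert _ _⟩ hAm
  have hlow : ∀ p ∈ Ioo 0 q, G p ≤ k := by
    intro p hp
    obtain ⟨r, hr, hpr⟩ := exists_lt_of_lt_csSup ⟨0, mem_insert _ _⟩ hp.2
    rcases hr with rfl | hr
    · exact absurd hpr (not_lt.2 hp.1.le)
    · exact (hG.monotoneOn ⟨hp.1, hpr.trans hr.1.2⟩ hr.1 hpr.le).trans hr.2
  have hhigh : ∀ p ∈ Ioo q m, k ≤ G p := by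
    intro p hp
    by_contra! hcon
    exact absurd (le_csSup hbdd (mem_insert_of_mem _ ⟨⟨hq0.trans_lt hp.1, hp.2⟩, hcon.le⟩))
      (not_le.2 hp.1)
  have hmax : IntegrableOn (fun p => max (k - G p) 0) (Ioo 0 m) := by
    have : IntegrableOn (fun p => k - G p) (Ioo 0 m) := (integrable_const k).sub hi
    exact this.pos_part
  have h1 : ∫ p in (0 : ℝ)..q, max (k - G p) 0 = q * k - legendre g q := by
    have : ∫ p in (0 : ℝ)..q, max (k - G p) 0 = ∫ p in (0 : ℝ)..q, (k - G p) := by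
      rw [intervalIntegral.integral_of_le hq0, intervalIntegral.integral_of_le hq0,
        integral_Ioc_eq_integral_Ioo, integral_Ioc_eq_integral_Ioo]
      exact setIntegral_congr_fun measurableSet_Ioo fun p hp =>
        max_eq_left (sub_nonneg.2 (hlow p hp))
    rw [this, intervalIntegral.integral_sub intervalIntegrable_const
      (intervalIntegrable_of_Ioo hi le_rfl hq0 hqm), hG.integral_eq hg hi ⟨hq0, hqm⟩]
    simp
  have h2 : ∫ p in q..m, max (k - G p) 0 = 0 := by
    rw [intervalIntegral.integral_of_le hqm, integral_Ioc_eq_integral_Ioo]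
    exact setIntegral_eq_zero_of_forall_eq_zero fun p hp =>
      max_eq_right (sub_nonpos.2 (hhigh p hp))
  rw [← intervalIntegral.integral_add_adjacent_intervals
    (intervalIntegrable_of_Ioo hmax le_rfl hq0 hqm)
    (intervalIntegrable_of_Ioo hmax hq0 hqm le_rfl), h1, h2]
  linarith [hg.le_legendre ⟨hq0, hqm⟩ k]

lemma IsArgmax.le_integral_hinge (hG : IsArgmax g m G) (hg : IsPotentialGap g m β)
    (hi : IntegrableOn G (Ioo 0 m)) (k : ℝ) {q : ℝ} (hq : q ∈ Icc 0 m) :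
    q * k - legendre g q ≤ ∫ p in (0 : ℝ)..m, max (k - G p) 0 := by
  have hsub : IntegrableOn (fun p => k - G p) (Ioo 0 m) := (integrable_const k).sub hi
  have hmax : IntegrableOn (fun p => max (k - G p) 0) (Ioo 0 m) := hsub.pos_part
  have h1 : ∫ p in (0 : ℝ)..q, (k - G p) = q * k - legendre g q := by
    rw [intervalIntegral.integral_sub intervalIntegrable_const
      (intervalIntegrable_of_Ioo hi le_rfl hq.1 hq.2), hG.integral_eq hg hi hq]
    simp
  have h2 : ∫ p in (0 : ℝ)..q, (k - G p) ≤ ∫ p in (0 : ℝ)..q, max (k - G p) 0 :=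
    intervalIntegral.integral_mono_on hq.1 (intervalIntegrable_of_Ioo hsub le_rfl hq.1 hq.2)
      (intervalIntegrable_of_Ioo hmax le_rfl hq.1 hq.2) fun p _ => le_max_left _ _
  have h3 : 0 ≤ ∫ p in q..m, max (k - G p) 0 :=
    intervalIntegral.integral_nonneg hq.2 fun p _ => le_max_right _ _
  rw [← intervalIntegral.integral_add_adjacent_intervals
    (intervalIntegrable_of_Ioo hmax le_rfl hq.1 hq.2)
    (intervalIntegrable_of_Ioo hmax hq.1 hq.2 le_rfl)]
  linarith

/-- Maximisers decrease when an increasing function is added to the gap. -/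
lemma IsArgmax.ae_le {g' G' : ℝ → ℝ} (hG : IsArgmax g m G) (hG' : IsArgmax g' m G')
    (hmono : Monotone fun k => g' k - g k) :
    ∀ᵐ p ∂(volume.restrict (Ioo 0 m)), G' p ≤ G p := by
  rw [ae_restrict_iff' measurableSet_Ioo]
  filter_upwards [hG.countable_not_continuousAt.ae_notMem volume] with p hp hpm
  have hc : ContinuousAt G p := by
    by_contra hcon
    exact hp ⟨hpm, hcon⟩
  refine ge_of_tendsto (hc.continuousWithinAt (s := Ioi p)).tendsto ?_
  filter_upwards [Ioo_mem_nhdsGT hpm.2] with q hq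
  have h1 := hG' p hpm (G q)
  have h2 := hG q ⟨hpm.1.trans hq.1, hq.2⟩ (G' p)
  by_contra! hcon
  have h3 := hmono hcon.le
  dsimp only at h3
  nlinarith [mul_pos (sub_pos.2 hq.1) (sub_pos.2 hcon)]

end Legendre

section Shadow

variable {μ ν : Measure ℝ}

lemma leCP.put_le (h : leCP μ ν) (k : ℝ) : put μ k ≤ put ν k := by
  have := h _ (linGrowth_affine_pos k (-1)) (convexOn_affine_pos k (-1)) fun _ => le_max_right _ _
  simpa only [put, neg_one_mul, ← sub_eq_add_neg] using this

lemma leCP.call_le (h : leCP μ ν) (k : ℝ) :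
    ∫ y, max (y - k) 0 ∂μ ≤ ∫ y, max (y - k) 0 ∂ν := by
  have := h _ (linGrowth_affine_pos (-k) 1) (convexOn_affine_pos (-k) 1)
    fun _ => le_max_right _ _
  simpa only [one_mul, neg_add_eq_sub] using this

lemma leC.leCP (h : leC μ ν) : leCP μ ν := fun φ h1 h2 _ => h φ h1 h2

lemma leCP.real_univ_le (h : leCP μ ν) : μ.real univ ≤ ν.real univ := by
  have := h _ (linGrowth_affine 1 0) (convexOn_affine 1 0) (by simp)
  simpa using this

lemma leC.real_univ_eq (h : leC μ ν) : μ.real univ = ν.real univ := by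
  have h1 := h _ (linGrowth_affine 1 0) (convexOn_affine 1 0)
  have h2 := h _ (linGrowth_affine (-1) 0) (convexOn_affine (-1) 0)
  simp only [zero_mul, add_zero, integral_const, smul_eq_mul] at h1 h2
  linarith

variable [IsFiniteMeasure μ] [IsFiniteMeasure ν]

lemma leCP.isPotentialGap (h : leCP μ ν) (hμ : Integrable (fun y => y) μ)
    (hν : Integrable (fun y => y) ν) (hm : μ.real univ < ν.real univ) :
    IsPotentialGap (fun k => put ν k - put μ k) (ν.real univ - μ.real univ)
      (∫ y, y ∂ν - ∫ y, y ∂μ) where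
  cont := (continuous_put hν).sub (continuous_put hμ)
  nonneg k := sub_nonneg.2 (h.put_le k)
  le k := by
    rw [put_eq_call hμ, put_eq_call hν]
    linarith [h.call_le k]
  tendsto_atBot := by simpa using (tendsto_put_atBot hν).sub (tendsto_put_atBot hμ)
  tendsto_atTop := by
    have h1 := ((tendsto_call_atTop hν).sub (tendsto_call_atTop hμ)).const_sub
      (∫ y, y ∂ν - ∫ y, y ∂μ)
    rw [sub_zero, sub_zero] at h1
    refine h1.congr fun k => ?_
    rw [put_eq_call hμ, put_eq_call hν]
    ring
  pos := sub_pos.2 hm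

/-- Two slopes whose maximisers lie in `(a, b]` differ by at most the mass of `(a, b]`. -/
lemma IsArgmax.sub_le_real_Iic {G : ℝ → ℝ} {m a b p q : ℝ}
    (hμ : Integrable (fun y => y) μ) (hν : Integrable (fun y => y) ν)
    (hG : IsArgmax (fun k => put ν k - put μ k) m G) (hp : p ∈ Ioo 0 m) (hq : q ∈ Ioo 0 m)
    (hpq : p ≤ q) (ha : a < G p) (hb : G q ≤ b) :
    q - p ≤ ν.real (Iic b) - ν.real (Iic a) := by
  set u := G p
  set v := G q
  have huv : u ≤ v := hG.monotoneOn hp hq hpq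
  have hc : ContinuousWithinAt (fun x => ν.real (Iic x)) (Ioi b) b :=
    (continuousWithinAt_real_Iic ν b).mono Ioi_subset_Ici_self
  refine ge_of_tendsto (hc.tendsto.sub_const _) ?_
  have hmem : Ioo b (b + (u - a)) ∈ nhdsWithin b (Ioi b) := Ioo_mem_nhdsGT (by linarith)
  filter_upwards [hmem] with c hc
  set h := c - b with hh
  have hpos : 0 < h := sub_pos.2 hc.1
  have h1 := hG p hp (u - h)
  have h2 := hG q hq (v + h)
  have e1 := put_sub_le hν (show v ≤ v + h by linarith)
  have e2 := le_put_sub hν (show u - h ≤ u by linarith)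
  have e3 := le_put_sub hμ (show v ≤ v + h by linarith)
  have e4 := put_sub_le hμ (show u - h ≤ u by linarith)
  have m1 : ν.real (Iic (v + h)) ≤ ν.real (Iic c) :=
    measureReal_mono (Iic_subset_Iic.2 (by linarith))
  have m2 : ν.real (Iic a) ≤ ν.real (Iic (u - h)) :=
    measureReal_mono (Iic_subset_Iic.2 (by linarith [hc.2]))
  have m3 : μ.real (Iic u) ≤ μ.real (Iic v) := measureReal_mono (Iic_subset_Iic.2 huv)
  have m1' := mul_le_mul_of_nonneg_left m1 hpos.le
  have m2' := mul_le_mul_of_nonneg_left m2 hpos.le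
  have m3' := mul_le_mul_of_nonneg_left m3 hpos.le
  refine le_of_mul_le_mul_left (a := h) ?_ hpos
  simp only [add_sub_cancel_left, sub_sub_cancel] at e1 e2 e3 e4
  change p * (u - h) - (put ν (u - h) - put μ (u - h)) ≤ p * u - (put ν u - put μ u) at h1
  change q * (v + h) - (put ν (v + h) - put μ (v + h)) ≤ q * v - (put ν v - put μ v) at h2
  linarith

/-- The law of the maximisers under Lebesgue measure on the slopes `(0, m)`. -/
def argmaxLaw (G : ℝ → ℝ) (m : ℝ) : Measure ℝ := (volume.restrict (Ioo 0 m)).map G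

instance (G : ℝ → ℝ) (m : ℝ) : IsFiniteMeasure (argmaxLaw G m) := by
  unfold argmaxLaw
  infer_instance

lemma IsArgmax.aemeasurable {g G : ℝ → ℝ} {m : ℝ} (hG : IsArgmax g m G) :
    AEMeasurable G (volume.restrict (Ioo 0 m)) :=
  aemeasurable_restrict_of_monotoneOn measurableSet_Ioo hG.monotoneOn

lemma IsArgmax.exists_add_argmaxLaw_eq {G : ℝ → ℝ} {m : ℝ}
    (hμ : Integrable (fun y => y) μ) (hν : Integrable (fun y => y) ν)
    (hG : IsArgmax (fun k => put ν k - put μ k) m G) :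
    ∃ ρ : Measure ℝ, ρ + argmaxLaw G m = ν := by
  refine exists_add_eq_of_real_Iic fun a b hab => ?_
  have hdiff : (argmaxLaw G m).real (Iic b) - (argmaxLaw G m).real (Iic a)
      = (argmaxLaw G m).real (Ioc a b) := by
    rw [← measureReal_sdiff (Iic_subset_Iic.2 hab) measurableSet_Iic, Iic_sdiff_Iic]
  have hF : 0 ≤ ν.real (Iic b) - ν.real (Iic a) :=
    sub_nonneg.2 (measureReal_mono (Iic_subset_Iic.2 hab))
  rw [hdiff]
  refine ENNReal.toReal_le_of_le_ofReal hF ?_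
  rw [argmaxLaw, Measure.map_apply_of_aemeasurable hG.aemeasurable measurableSet_Ioc,
    Measure.restrict_apply' measurableSet_Ioo]
  refine (Real.volume_le_diam _).trans (Metric.ediam_le fun p hp q hq => ?_)
  rw [edist_dist]
  refine ENNReal.ofReal_le_ofReal ?_
  rw [Real.dist_eq]
  refine abs_sub_le_iff.2 ⟨?_, ?_⟩
  · rcases le_total q p with h | h
    · exact hG.sub_le_real_Iic hμ hν hq.2 hp.2 h hq.1.1 hp.1.2
    · linarith
  · rcases le_total p q with h | h
    · exact hG.sub_le_real_Iic hμ hν hp.2 hq.2 h hp.1.1 hq.1.2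
    · linarith

lemma integral_argmaxLaw {g G φ : ℝ → ℝ} {m : ℝ} (hG : IsArgmax g m G) (hφ : Measurable φ) :
    ∫ y, φ y ∂(argmaxLaw G m) = ∫ p in Ioo 0 m, φ (G p) :=
  integral_map hG.aemeasurable hφ.aestronglyMeasurable

lemma IsArgmax.put_argmaxLaw {g G : ℝ → ℝ} {m : ℝ} (hG : IsArgmax g m G) (hm : 0 ≤ m) (k : ℝ) :
    put (argmaxLaw G m) k = ∫ p in (0 : ℝ)..m, max (k - G p) 0 := by
  rw [intervalIntegral.integral_of_le hm, integral_Ioc_eq_integral_Ioo, put,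
    integral_argmaxLaw hG (by fun_prop)]

lemma put_add (hμ : Integrable (fun y => y) μ) (hν : Integrable (fun y => y) ν) (k : ℝ) :
    put (μ + ν) k = put μ k + put ν k :=
  integral_add_measure (integrable_hinge hμ k) (integrable_hinge hν k)

/-- The complement in `ν` of the shadow of a sum of atoms is the law of the maximisers of the
potential gap. -/
lemma IsShadow.add_argmaxLaw_eq {ι : Type*} [Fintype ι] {α : ℝ} {x : ι → ℝ} {η : Measure ℝ}
    {G : ℝ → ℝ} (hdef : μ = ENNReal.ofReal α • ∑ i, Measure.dirac (x i))
    (hμ : Integrable (fun y => y) μ) (hν : Integrable (fun y => y) ν)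
    (hle : leCP μ ν) (hη : IsShadow μ ν η) (hm : μ.real univ < ν.real univ)
    (hG : IsArgmax (fun k => put ν k - put μ k) (ν.real univ - μ.real univ) G) :
    η + argmaxLaw G (ν.real univ - μ.real univ) = ν := by
  have hg := hle.isPotentialGap hμ hν hm
  set m := ν.real univ - μ.real univ with hm_def
  have hm0 : 0 ≤ m := hg.pos.le
  obtain ⟨ρ, hρ⟩ := hG.exists_add_argmaxLaw_eq hμ hν
  set θ := argmaxLaw G m with hθ
  have hρν : ρ ≤ ν := by rw [← hρ]; exact Measure.le_add_right le_rfl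
  have hθν : θ ≤ ν := by rw [← hρ]; exact Measure.le_add_left le_rfl
  obtain ⟨hμη, hην, hmin⟩ := hη
  have fρ : IsFiniteMeasure ρ := isFiniteMeasure_of_le ν hρν
  have fη : IsFiniteMeasure η := isFiniteMeasure_of_le ν hην
  have iρ := hν.mono_measure hρν
  have iθ := hν.mono_measure hθν
  have iη := hν.mono_measure hην
  have hGi : IntegrableOn G (Ioo 0 m) :=
    (integrable_map_measure (by fun_prop) hG.aemeasurable).1 iθ
  have hθmass : θ.real univ = m := by
    rw [hθ, argmaxLaw, Measure.real, Measure.map_apply_of_aemeasurable hG.aemeasurable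
      MeasurableSet.univ]
    simp [hm0]
  have hθmean : ∫ y, y ∂θ = ∫ y, y ∂ν - ∫ y, y ∂μ := by
    rw [hθ, integral_argmaxLaw hG measurable_id', ← integral_Ioc_eq_integral_Ioo,
      ← intervalIntegral.integral_of_le hm0, hG.integral_eq hg hGi ⟨hm0, le_rfl⟩,
      hg.legendre_right]
  have hθput : ∀ k, put θ k = ∫ p in (0 : ℝ)..m, max (k - G p) 0 := hG.put_argmaxLaw hm0
  have hνput : ∀ k, put ν k = put ρ k + put θ k := fun k => by rw [← put_add iρ iθ, hρ]
  have hμρ : leC μ ρ := by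
    refine leC_of_put_le x hdef hμ iρ ?_ ?_ fun k => ?_
    · have : ν.real univ = ρ.real univ + θ.real univ := by rw [← hρ, measureReal_add_apply]
      linarith
    · have : ∫ y, y ∂ν = ∫ y, y ∂ρ + ∫ y, y ∂θ := by rw [← hρ, integral_add_measure iρ iθ]
      linarith
    · have h1 := hG.integral_hinge_le hg hGi k
      rw [← hθput] at h1
      linarith [hνput k]
  have hηρ : leC η ρ := hmin ρ hμρ hρν
  have hput_le : ∀ k, put ρ k ≤ put η k := by
    intro k
    set θ' := ν - η with hθ'
    have hsum : θ' + η = ν := Measure.sub_add_cancel_of_le hην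
    have hθ'ν : θ' ≤ ν := Measure.sub_le
    have fθ' : IsFiniteMeasure θ' := isFiniteMeasure_of_le ν hθ'ν
    have iθ' := hν.mono_measure hθ'ν
    have hput' : ∀ y, put ν y = put θ' y + put η y := fun y => by rw [← put_add iθ' iη, hsum]
    set q := θ'.real (Iic k) with hq
    have hqm : q ∈ Icc 0 m := by
      refine ⟨measureReal_nonneg, (measureReal_mono (subset_univ _)).trans_eq ?_⟩
      have : ν.real univ = θ'.real univ + η.real univ := by
        rw [← hsum, measureReal_add_apply]
      linarith [hμη.real_univ_eq]
    have h1 : legendre (fun k => put ν k - put μ k) q ≤ q * k - put θ' k := by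
      refine ciSup_le fun y => ?_
      have := put_supporting_line iθ' k y
      rw [← hq] at this
      linarith [hput' y, hμη.leCP.put_le y]
    have h2 := hG.le_integral_hinge hg hGi k hqm
    rw [← hθput] at h2
    linarith [hput' k, hνput k]
  have : η = ρ := eq_of_put_eq iη iρ <| funext fun k =>
    le_antisymm (hηρ.leCP.put_le k) (hput_le k)
  rw [this, hρ]

lemma leSto.put_sub_mono (h : leSto μ ν) (hμ : Integrable (fun y => y) μ)
    (hν : Integrable (fun y => y) ν) : Monotone fun k => put μ k - put ν k := by
  intro l k hlk
  have hlin : LinGrowth fun y => max (l - y) 0 - max (k - y) 0 := by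
    refine ⟨k - l, fun y => ?_⟩
    have h1 : |max (l - y) 0 - max (k - y) 0| ≤ |(l - y) - (k - y)| := abs_max_sub_max_le_abs _ _ _
    have h2 : |(l - y) - (k - y)| = k - l := by
      rw [abs_of_nonpos (by linarith)]; ring
    nlinarith [abs_nonneg y, mul_nonneg (sub_nonneg.2 hlk) (abs_nonneg y)]
  have hmon : Monotone fun y => max (l - y) 0 - max (k - y) 0 := by
    intro y z hyz
    dsimp only
    rcases max_cases (l - y) 0 with h1 | h1 <;> rcases max_cases (k - y) 0 with h2 | h2 <;>
    rcases max_cases (l - z) 0 with h3 | h3 <;> rcases max_cases (k - z) 0 with h4 | h4 <;>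
    linarith
  have := h _ hlin hmon
  rw [integral_sub (integrable_hinge hμ l) (integrable_hinge hμ k),
    integral_sub (integrable_hinge hν l) (integrable_hinge hν k)] at this
  change put μ l - put μ k ≤ put ν l - put ν k at this
  dsimp only
  linarith

end Shadow

lemma IsShadow.eq_of_real_univ_eq {μ ν η : Measure ℝ} [IsFiniteMeasure ν] (hη : IsShadow μ ν η)
    (h : μ.real univ = ν.real univ) : η = ν := by
  have fη : IsFiniteMeasure η := isFiniteMeasure_of_le ν hη.2.1
  refine Measure.eq_of_le_of_measure_univ_eq hη.2.1 ?_
  exact (measureReal_eq_measureReal_iff).1 (hη.1.real_univ_eq.symm.trans h)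

lemma isFiniteMeasure_atoms {ι : Type*} [Fintype ι] (α : ℝ) (x : ι → ℝ) :
    IsFiniteMeasure (ENNReal.ofReal α • ∑ i, Measure.dirac (x i)) :=
  Measure.smul_finite _ ENNReal.ofReal_ne_top

lemma integrable_atoms {ι : Type*} [Fintype ι] (α : ℝ) (x : ι → ℝ) :
    Integrable (fun y => y) (ENNReal.ofReal α • ∑ i, Measure.dirac (x i)) :=
  (integrable_finsetSum_measure.2 fun _ _ =>
    integrable_dirac (by simp)).smul_measure ENNReal.ofReal_ne_top

/-- monotonicity of the shadow projection on sums of `n` atoms of equal mass. -/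
theorem shadow_mono_atoms (n : ℕ) (hn : 1 ≤ n) (α : ℝ) (hα : 0 < α) (x x' : Fin n → ℝ)
    (ν : Measure ℝ) (hν : MemM ν)
    (hsto : leSto (ENNReal.ofReal α • ∑ i : Fin n, Measure.dirac (x i))
                  (ENNReal.ofReal α • ∑ i : Fin n, Measure.dirac (x' i)))
    (h₁ : leCP (ENNReal.ofReal α • ∑ i : Fin n, Measure.dirac (x i)) ν)
    (h₂ : leCP (ENNReal.ofReal α • ∑ i : Fin n, Measure.dirac (x' i)) ν)
    (η η' : Measure ℝ)
    (hη : IsShadow (ENNReal.ofReal α • ∑ i : Fin n, Measure.dirac (x i)) ν η)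
    (hη' : IsShadow (ENNReal.ofReal α • ∑ i : Fin n, Measure.dirac (x' i)) ν η') :
    leSto η η' := by
  obtain ⟨fν, iν⟩ := hν
  have fμ := isFiniteMeasure_atoms α x
  have fμ' := isFiniteMeasure_atoms α x'
  have iμ := integrable_atoms α x
  have iμ' := integrable_atoms α x'
  have hmass : (ENNReal.ofReal α • ∑ i : Fin n, Measure.dirac (x i)).real univ
      = (ENNReal.ofReal α • ∑ i : Fin n, Measure.dirac (x' i)).real univ := by
    simp [Measure.real]
  generalize hμ : ENNReal.ofReal α • ∑ i : Fin n, Measure.dirac (x i) = μ at *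
  generalize hμ' : ENNReal.ofReal α • ∑ i : Fin n, Measure.dirac (x' i) = μ' at *
  rcases h₁.real_univ_le.eq_or_lt with heq | hlt
  · rw [hη.eq_of_real_univ_eq heq, hη'.eq_of_real_univ_eq (hmass.symm.trans heq)]
    exact fun φ _ _ => le_rfl
  have hlt' := hmass ▸ hlt
  obtain ⟨G, hG⟩ := (h₁.isPotentialGap iμ iν hlt).exists_isArgmax
  obtain ⟨G', hG'⟩ := (h₂.isPotentialGap iμ' iν hlt').exists_isArgmax
  have e := hη.add_argmaxLaw_eq hμ.symm iμ iν h₁ hlt hG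
  have e' := hη'.add_argmaxLaw_eq hμ'.symm iμ' iν h₂ hlt' hG'
  rw [← hmass] at hG' e'
  have hGG : ∀ᵐ p ∂(volume.restrict (Ioo 0 (ν.real univ - μ.real univ))), G' p ≤ G p := by
    refine hG.ae_le hG' ?_
    convert hsto.put_sub_mono iμ iμ' using 2
    ring
  intro φ hφ hmono
  have iφ := integrable_of_linGrowth iν hφ hmono.measurable
  have hsub := iφ.mono_measure (show argmaxLaw G _ ≤ ν from e ▸ Measure.le_add_left le_rfl)
  have hsub' := iφ.mono_measure (show argmaxLaw G' _ ≤ ν from e' ▸ Measure.le_add_left le_rfl)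
  have s := integral_add_measure (iφ.mono_measure hη.2.1) hsub
  have s' := integral_add_measure (iφ.mono_measure hη'.2.1) hsub'
  rw [e] at s
  rw [e'] at s'
  have hle : ∫ y, φ y ∂(argmaxLaw G' (ν.real univ - μ.real univ))
      ≤ ∫ y, φ y ∂(argmaxLaw G (ν.real univ - μ.real univ)) := by
    rw [integral_argmaxLaw hG hmono.measurable, integral_argmaxLaw hG' hmono.measurable]
    refine integral_mono_ae ?_ ?_ (hGG.mono fun p hp => hmono hp)
    · exact (integrable_map_measure hmono.measurable.aestronglyMeasurable hG'.aemeasurable).1 hsub'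
    · exact (integrable_map_measure hmono.measurable.aestronglyMeasurable hG.aemeasurable).1 hsub
  linarith

end
end

section
/- Let μ, μ′ ∈ M have the same total mass and let ν ∈ M satisfy μ ≤_{C,+} ν and μ′ ≤_{C,+} ν. Then W(S^ν(μ), S^ν(μ′)) ≤ W(μ, μ′): the shadow projection into a fixed target ν is 1-Lipschitz in its first argument for the Kantorovich distance. -/
open MeasureTheory Set Filter ProbabilityTheory

noncomputable section

/-- `k` is the greatest convex minorant of `f`. -/
def IsGCM (f k : ℝ → ℝ) : Prop :=
  ConvexOn ℝ univ k ∧ (∀ x, k x ≤ f x) ∧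
    ∀ j : ℝ → ℝ, ConvexOn ℝ univ j → (∀ x, j x ≤ f x) → ∀ x, j x ≤ k x

lemma convexOn_univ_iff_le_affine {w : ℝ → ℝ} :
    ConvexOn ℝ univ w ↔ ∀ p s q α β : ℝ, p ≤ s → s ≤ q → w p ≤ α + β * p → w q ≤ α + β * q →
      w s ≤ α + β * s := by
  constructor
  · intro h p s q α β hps hsq hp hq
    have hs : s ∈ segment ℝ p q := by rw [segment_eq_Icc (hps.trans hsq)]; exact ⟨hps, hsq⟩
    obtain ⟨a, b, ha, hb, hab, rfl⟩ := hs
    have h1 := h.2 (mem_univ p) (mem_univ q) ha hb hab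
    simp only [smul_eq_mul] at h1 ⊢
    have h2 := mul_le_mul_of_nonneg_left hp ha
    have h3 := mul_le_mul_of_nonneg_left hq hb
    have h4 : a * (α + β * p) + b * (α + β * q) = α + β * (a * p + b * q) := by
      linear_combination α * hab
    linarith
  · intro h
    refine LinearOrder.convexOn_of_lt convex_univ ?_
    intro x _ y _ hxy a b ha hb hab
    have hd : y - x ≠ 0 := by linarith
    obtain rfl : a = 1 - b := by linarith
    have := h x ((1 - b) • x + b • y) y (w x - (w y - w x) / (y - x) * x)
      ((w y - w x) / (y - x)) (by simp only [smul_eq_mul]; nlinarith)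
      (by simp only [smul_eq_mul]; nlinarith) (by linarith)
      (le_of_eq (by field_simp; ring))
    refine this.trans (le_of_eq ?_)
    simp only [smul_eq_mul]
    field_simp
    ring

lemma ConvexOn.continuous_of_univ {w : ℝ → ℝ} (h : ConvexOn ℝ univ w) : Continuous w :=
  continuousOn_univ.1 (h.continuousOn isOpen_univ)

lemma exists_isGCM {f k₀ : ℝ → ℝ} (hk : ConvexOn ℝ univ k₀) (hle : ∀ x, k₀ x ≤ f x) :
    ∃ k, IsGCM f k := by
  let S : ℝ → Set ℝ := fun x => {y | ∃ j : ℝ → ℝ, ConvexOn ℝ univ j ∧ (∀ x, j x ≤ f x) ∧ y = j x}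
  have hb : ∀ x, BddAbove (S x) := fun x => ⟨f x, by rintro _ ⟨j, -, hj, rfl⟩; exact hj x⟩
  have hne : ∀ x, (S x).Nonempty := fun x => ⟨_, k₀, hk, hle, rfl⟩
  refine ⟨fun x => sSup (S x), ?_, ?_, ?_⟩
  · rw [convexOn_univ_iff_le_affine]
    intro p s q α β hps hsq hp hq
    refine csSup_le (hne s) ?_
    rintro _ ⟨j, hj, hjf, rfl⟩
    exact convexOn_univ_iff_le_affine.1 hj p s q α β hps hsq
      ((le_csSup (hb p) ⟨j, hj, hjf, rfl⟩).trans hp) ((le_csSup (hb q) ⟨j, hj, hjf, rfl⟩).trans hq)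
  · intro x
    refine csSup_le (hne x) ?_
    rintro _ ⟨j, -, hj, rfl⟩
    exact hj x
  · intro j hj hjf x
    exact le_csSup (hb x) ⟨j, hj, hjf, rfl⟩

/-- Gluing: replacing `a` by `max a b` to the left of a point where `b ≤ a` preserves convexity. -/
lemma convexOn_max_left {a b : ℝ → ℝ} {t : ℝ} (ha : ConvexOn ℝ univ a) (hb : ConvexOn ℝ univ b)
    (ht : b t ≤ a t) : ConvexOn ℝ univ (fun x => if x ≤ t then max (a x) (b x) else a x) := by
  have haw : ∀ x, a x ≤ (fun x => if x ≤ t then max (a x) (b x) else a x) x := by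
    intro x; dsimp only; split_ifs <;> simp
  rw [convexOn_univ_iff_le_affine] at *
  intro p s q α β hps hsq hp hq
  have h := fun s hps hsq => ha p s q α β hps hsq ((haw p).trans hp) ((haw q).trans hq)
  split_ifs with hs
  · refine max_le (h s hps hsq) ?_
    rw [if_pos (hps.trans hs)] at hp
    have hbp : b p ≤ α + β * p := (le_max_right _ _).trans hp
    by_cases hqt : q ≤ t
    · rw [if_pos hqt] at hq
      exact hb p s q α β hps hsq hbp ((le_max_right _ _).trans hq)
    · exact hb p s t α β hps hs hbp (ht.trans (h t (hps.trans hs) (not_le.1 hqt).le))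
  · exact h s hps hsq

lemma ConvexOn.comp_neg_univ {a : ℝ → ℝ} (ha : ConvexOn ℝ univ a) :
    ConvexOn ℝ univ (fun x => a (-x)) := by
  refine ⟨convex_univ, fun x _ y _ s t hs ht hst => ?_⟩
  have := ha.2 (mem_univ (-x)) (mem_univ (-y)) hs ht hst
  simp only [smul_eq_mul] at *
  convert this using 2
  ring

lemma convexOn_max_right {a b : ℝ → ℝ} {t : ℝ} (ha : ConvexOn ℝ univ a) (hb : ConvexOn ℝ univ b)
    (ht : b t ≤ a t) : ConvexOn ℝ univ (fun x => if t ≤ x then max (a x) (b x) else a x) := by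
  have := (convexOn_max_left (t := -t) ha.comp_neg_univ hb.comp_neg_univ
    (by simpa using ht)).comp_neg_univ
  simpa using this

/-- The greatest convex minorant is monotone for the order `h - f` nondecreasing. -/
lemma IsGCM.monotone_sub {f h kf kh : ℝ → ℝ} (hf : IsGCM f kf) (hh : IsGCM h kh)
    (hmono : Monotone fun x => h x - f x) : Monotone fun x => kh x - kf x := by
  intro x y hxy
  by_contra! hlt
  obtain ⟨c, hc1, hc2⟩ := exists_between hlt
  have hcont : ContinuousOn (fun t => kh t - kf t) (Icc x y) :=
    (hh.1.continuous_of_univ.sub hf.1.continuous_of_univ).continuousOn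
  obtain ⟨t, ⟨hxt, hty⟩, ht⟩ := intermediate_value_Icc' hxy hcont ⟨hc1.le, hc2.le⟩
  dsimp only at ht
  rcases le_total (h t - f t) c with hz | hz
  · have hconv := convexOn_max_left (t := t) hf.1 (hh.1.add_const (-c))
      (by simp only [Pi.add_apply]; linarith)
    have := hf.2.2 _ hconv ?_ x
    · rw [if_pos hxt] at this
      have := (le_max_right _ _).trans this
      simp only [Pi.add_apply] at this
      linarith
    · intro s
      split_ifs with hs
      · refine max_le (hf.2.1 s) ?_
        have h1 := hmono hs
        have h2 := hh.2.1 s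
        simp only [Pi.add_apply] at h1 ⊢
        linarith
      · exact hf.2.1 s
  · have hconv := convexOn_max_right (t := t) hh.1 (hf.1.add_const c)
      (by simp only [Pi.add_apply]; linarith)
    have := hh.2.2 _ hconv ?_ y
    · rw [if_pos hty] at this
      have := (le_max_right _ _).trans this
      simp only [Pi.add_apply] at this
      linarith
    · intro s
      split_ifs with hs
      · refine max_le (hh.2.1 s) ?_
        have h1 := hmono hs
        have h2 := hf.2.1 s
        simp only [Pi.add_apply] at h1 ⊢
        linarith
      · exact hh.2.1 s

lemma IsGCM.midpoint_le {f k : ℝ → ℝ} (hk : IsGCM f k) (hf : Continuous f) {x : ℝ}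
    (hx : k x < f x) : ∀ᶠ ε in nhdsWithin (0 : ℝ) (Ioi 0), (k (x - ε) + k (x + ε)) / 2 ≤ k x := by
  obtain ⟨c, hc1, hc2⟩ := exists_between hx
  have h1 : ∀ᶠ y in nhds x, c < f y := hf.continuousAt.eventually (lt_mem_nhds hc2)
  have h2 : ∀ᶠ y in nhds x, k y < c :=
    hk.1.continuous_of_univ.continuousAt.eventually (gt_mem_nhds hc1)
  obtain ⟨δ, hδ, hball⟩ := Metric.eventually_nhds_iff.1 (h1.and h2)
  filter_upwards [Ioo_mem_nhdsGT hδ] with ε hε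
  obtain ⟨β, hβ⟩ : ∃ β, β = (k (x + ε) - k (x - ε)) / (2 * ε) := ⟨_, rfl⟩
  obtain ⟨α, hα⟩ : ∃ α, α = k (x - ε) - β * (x - ε) := ⟨_, rfl⟩
  have hε0 : ε ≠ 0 := hε.1.ne'
  have hl : k (x - ε) = α + β * (x - ε) := by rw [hα]; ring
  have hr : k (x + ε) = α + β * (x + ε) := by rw [hα, hβ]; field_simp; ring
  have hlc : k (x - ε) < c := (hball (by simpa [Real.dist_eq, abs_of_pos hε.1] using hε.2)).2
  have hrc : k (x + ε) < c := (hball (by simpa [Real.dist_eq, abs_of_pos hε.1] using hε.2)).2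
  have hk' := convexOn_univ_iff_le_affine.1 hk.1
  have hline : ConvexOn ℝ univ (fun s : ℝ => α + β * s) := by
    rw [convexOn_univ_iff_le_affine]
    intro p s q α' β' hps hsq hp hq
    rcases hps.eq_or_lt with rfl | hps
    · exact hp
    nlinarith
  have hmax : ConvexOn ℝ univ (k ⊔ fun s : ℝ => α + β * s) := hk.1.sup hline
  have key := hk.2.2 _ hmax ?_ x
  · have := (le_max_right _ _).trans key
    rw [hl, hr]
    linarith
  · intro s
    refine max_le (hk.2.1 s) ?_
    dsimp only
    by_cases hs : |s - x| ≤ ε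
    · have hs' := abs_le.1 hs
      have hfs : c < f s := (hball (by rw [Real.dist_eq]; exact hs.trans_lt hε.2)).1
      refine le_trans ?_ hfs.le
      rcases le_total 0 β with hb | hb <;> nlinarith
    · refine le_trans ?_ (hk.2.1 s)
      by_contra! hcon
      rw [not_le, lt_abs] at hs
      rcases hs with hs | hs
      · obtain ⟨m, hm⟩ : ∃ m, m = (k s - k (x - ε)) / (s - (x - ε)) := ⟨_, rfl⟩
        have hpos : 0 < s - (x - ε) := by linarith [hε.1]
        have hms : k (x - ε) + m * (s - (x - ε)) = k s := by rw [hm]; field_simp; ring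
        have := hk' (x - ε) (x + ε) s (k (x - ε) - m * (x - ε)) m (by linarith [hε.1])
          (by linarith) (by linarith) (by linarith)
        have hlt : m < β := by
          by_contra! hge
          nlinarith
        nlinarith [hε.1]
      · obtain ⟨m, hm⟩ : ∃ m, m = (k (x + ε) - k s) / ((x + ε) - s) := ⟨_, rfl⟩
        have hpos : 0 < (x + ε) - s := by linarith [hε.1]
        have hms : k (x + ε) - m * ((x + ε) - s) = k s := by rw [hm]; field_simp; ring
        have := hk' s (x - ε) (x + ε) (k (x + ε) - m * (x + ε)) m (by linarith [hε.1])
          (by linarith [hε.1]) (by linarith) (by linarith)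
        have hlt : β < m := by
          by_contra! hge
          nlinarith
        nlinarith [hε.1]

/-- If `k` is the greatest convex minorant of `a - b` with `a`, `b` convex, then `a - k` is
convex. -/
lemma IsGCM.convexOn_sub {a b k : ℝ → ℝ} (ha : ConvexOn ℝ univ a) (hb : ConvexOn ℝ univ b)
    (hk : IsGCM (fun x => a x - b x) k) : ConvexOn ℝ univ (fun x => a x - k x) := by
  have hac := ha.continuous_of_univ
  have hkc := hk.1.continuous_of_univ
  rw [convexOn_univ_iff_le_affine]
  intro p s q α β hps hsq hp hq
  by_contra! hlt
  let d : ℝ → ℝ := fun t => a t - k t - (α + β * t)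
  have hd : Continuous d := by fun_prop
  obtain ⟨z, hz, hzmax⟩ := isCompact_Icc.exists_isMaxOn (nonempty_Icc.2 (hps.trans hsq))
    (hd.continuousOn (s := Icc p q))
  have hm0 : 0 < d z := lt_of_lt_of_le (by simp only [d]; linarith) (hzmax ⟨hps, hsq⟩)
  have hcpt : IsCompact (Icc p q ∩ d ⁻¹' {d z}) :=
    isCompact_Icc.inter_right (isClosed_singleton.preimage hd)
  obtain ⟨x, ⟨hxI, hxm⟩, hleast⟩ := hcpt.exists_isLeast ⟨z, hz, rfl⟩
  have hxm : d x = d z := hxm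
  have hpx : p < x := by
    rcases hxI.1.eq_or_lt with h | h
    · subst h; simp only [d] at hxm hm0; linarith
    · exact h
  have hxq : x < q := by
    rcases hxI.2.eq_or_lt with h | h
    · subst h; simp only [d] at hxm hm0; linarith
    · exact h
  by_cases hcontact : k x < a x - b x
  · have hev := hk.midpoint_le (hac.sub hb.continuous_of_univ) hcontact
    have hsmall : ∀ᶠ ε in nhdsWithin (0 : ℝ) (Ioi 0), ε ∈ Ioo 0 (min (x - p) (q - x)) :=
      Ioo_mem_nhdsGT (lt_min (by linarith) (by linarith))
    obtain ⟨ε, h1, h2, h3⟩ := (hev.and hsmall).exists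
    have h4 := h3.trans_le (min_le_left _ _)
    have h5 := h3.trans_le (min_le_right _ _)
    have hmr : d (x + ε) ≤ d z := hzmax ⟨by linarith, by linarith⟩
    have hml : d (x - ε) < d z := by
      refine lt_of_le_of_ne (hzmax ⟨by linarith, by linarith⟩) fun h => ?_
      have := hleast ⟨⟨by linarith, by linarith⟩, h⟩
      linarith
    have hmid := ha.2 (mem_univ (x - ε)) (mem_univ (x + ε)) (show (0 : ℝ) ≤ 1 / 2 by norm_num)
      (show (0 : ℝ) ≤ 1 / 2 by norm_num) (by norm_num)
    have e : (1 / 2 : ℝ) • (x - ε) + (1 / 2 : ℝ) • (x + ε) = x := by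
      simp only [smul_eq_mul]; ring
    rw [e] at hmid
    simp only [smul_eq_mul] at hmid
    simp only [d] at hxm hml hmr
    linarith
  · have h1 := convexOn_univ_iff_le_affine.1 hb p x q α β hxI.1 hxI.2
      (by have := hk.2.1 p; dsimp only at this; linarith)
      (by have := hk.2.1 q; dsimp only at this; linarith)
    simp only [d] at hxm hm0
    linarith

/-- A convex function on `ℝ` is the integral of a right-continuous monotone slope. -/
lemma ConvexOn.exists_stieltjes_slope {φ : ℝ → ℝ} (h : ConvexOn ℝ univ φ) :
    ∃ r : StieltjesFunction ℝ, ∀ x y, ∫ t in x..y, r t = φ y - φ x := by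
  have hmem : ∀ x : ℝ, x ∈ interior (univ : Set ℝ) := by simp
  have hm : Monotone fun x => derivWithin φ (Ioi x) x := by
    intro x y hxy
    exact h.monotoneOn_rightDeriv (hmem x) (hmem y) hxy
  refine ⟨hm.stieltjesFunction, fun x y => ?_⟩
  rw [← intervalIntegral.integral_eq_sub_of_hasDeriv_right h.continuous_of_univ.continuousOn
    (fun x _ => h.hasDerivWithinAt_rightDeriv_of_mem_interior (hmem x)) hm.intervalIntegrable]
  refine intervalIntegral.integral_congr_ae ?_
  have hnull : ∀ᵐ t : ℝ, ContinuousAt (fun x => derivWithin φ (Ioi x) x) t := by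
    have := hm.countable_not_continuousAt.measure_zero volume
    exact this
  filter_upwards [hnull] with t ht _
  rw [hm.stieltjesFunction_eq]
  exact ht.continuousWithinAt.rightLim_eq

/-- A right-continuous function with nonnegative integrals over all intervals is nonnegative. -/
lemma nonneg_of_intervalIntegral_nonneg {r : ℝ → ℝ}
    (hr : ∀ x, ContinuousWithinAt r (Ici x) x) (hint : ∀ x y, IntervalIntegrable r volume x y)
    (h : ∀ x y, x ≤ y → 0 ≤ ∫ t in x..y, r t) (x : ℝ) : 0 ≤ r x := by
  by_contra! hx
  have h1 : ∀ᶠ t in nhdsWithin x (Ici x), r t < r x / 2 :=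
    (hr x).eventually (gt_mem_nhds (by linarith))
  obtain ⟨y, hxy, hy⟩ := (mem_nhdsGE_iff_exists_Icc_subset).1 h1
  have h2 : ∫ t in x..y, r t ≤ ∫ t in x..y, r x / 2 :=
    intervalIntegral.integral_mono_on (le_of_lt hxy) (hint x y) (by simp)
      fun t ht => (show r t < r x / 2 from hy ht).le
  have h3 := h x y (le_of_lt hxy)
  rw [intervalIntegral.integral_const, smul_eq_mul] at h2
  have hxy : x < y := hxy
  nlinarith

lemma slope_bounded_of_linGrowth {φ r : ℝ → ℝ} (hr : Monotone r) (hφ : LinGrowth φ)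
    (h : ∀ x y, ∫ t in x..y, r t = φ y - φ x) : ∃ L, ∀ t, |r t| ≤ L := by
  obtain ⟨C, hC⟩ := hφ
  refine ⟨3 * C, fun t => ?_⟩
  have hC0 : 0 ≤ C := by
    have := (abs_nonneg _).trans (hC 0)
    simpa using this
  obtain ⟨d, hd⟩ : ∃ d, d = 1 + |t| := ⟨_, rfl⟩
  have hd1 : 0 < d := by rw [hd]; positivity
  have b0 := abs_le.1 (hC t)
  have b1 := abs_le.1 (hC (t + d))
  have b2 := abs_le.1 (hC (t - d))
  have e1 : C * (1 + |t + d|) ≤ C * (2 * d) := by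
    refine mul_le_mul_of_nonneg_left ?_ hC0
    have := abs_add_le t d
    rw [abs_of_pos hd1] at this
    linarith
  have e2 : C * (1 + |t - d|) ≤ C * (2 * d) := by
    refine mul_le_mul_of_nonneg_left ?_ hC0
    have := abs_sub t d
    rw [abs_of_pos hd1] at this
    linarith
  rw [← hd] at b0
  have h1 : ∫ s in t..(t + d), r t ≤ ∫ s in t..(t + d), r s :=
    intervalIntegral.integral_mono_on (by linarith) (by simp) hr.intervalIntegrable
      fun s hs => hr hs.1
  have h2 : ∫ s in (t - d)..t, r s ≤ ∫ s in (t - d)..t, r t :=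
    intervalIntegral.integral_mono_on (by linarith) hr.intervalIntegrable (by simp)
      fun s hs => hr hs.2
  rw [h, intervalIntegral.integral_const, smul_eq_mul] at h1 h2
  rw [abs_le]
  constructor
  · by_contra! hcon
    nlinarith
  · by_contra! hcon
    nlinarith

/-- The call potential of a measure. -/
def callPot (μ : Measure ℝ) (x : ℝ) : ℝ := ∫ y, max (y - x) 0 ∂μ

lemma MemM.integrable_of_linGrowth {μ : Measure ℝ} (hμ : MemM μ) {φ : ℝ → ℝ} (hφ : LinGrowth φ)
    (hc : Continuous φ) : Integrable φ μ := by
  have := hμ.1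
  obtain ⟨C, hC⟩ := hφ
  exact (((integrable_const 1).add hμ.2.abs).const_mul C).mono' hc.aestronglyMeasurable
    (.of_forall hC)

lemma linGrowth_call (x : ℝ) : LinGrowth fun y => max (y - x) 0 := by
  refine ⟨1 + |x|, fun y => ?_⟩
  have h1 : |max (y - x) 0| ≤ |y - x| := by
    rw [abs_of_nonneg (le_max_right _ _)]
    exact max_le (le_abs_self _) (abs_nonneg _)
  have h2 := abs_sub y x
  nlinarith [abs_nonneg x, abs_nonneg y, mul_nonneg (abs_nonneg x) (abs_nonneg y)]

lemma MemM.integrable_call {μ : Measure ℝ} (hμ : MemM μ) (x : ℝ) :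
    Integrable (fun y => max (y - x) 0) μ :=
  hμ.integrable_of_linGrowth (linGrowth_call x) (by fun_prop)

lemma convexOn_call (x : ℝ) : ConvexOn ℝ univ fun y : ℝ => max (y - x) 0 := by
  have h1 : ConvexOn ℝ univ fun y : ℝ => y - x := by
    simpa [sub_eq_add_neg] using! (convexOn_id convex_univ).add_const (-x)
  exact h1.sup (convexOn_const 0 convex_univ)

lemma MemM.convexOn_callPot {μ : Measure ℝ} (hμ : MemM μ) : ConvexOn ℝ univ (callPot μ) := by
  refine ⟨convex_univ, fun x _ y _ a b ha hb hab => ?_⟩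
  simp only [callPot, smul_eq_mul]
  rw [← integral_const_mul, ← integral_const_mul,
    ← integral_add ((hμ.integrable_call x).const_mul a) ((hμ.integrable_call y).const_mul b)]
  refine integral_mono (hμ.integrable_call _)
    (((hμ.integrable_call x).const_mul a).add ((hμ.integrable_call y).const_mul b)) fun z => ?_
  have h1 := mul_le_mul_of_nonneg_left (le_max_left (z - x) 0) ha
  have h2 := mul_le_mul_of_nonneg_left (le_max_left (z - y) 0) hb
  have h3 := mul_nonneg ha (le_max_right (z - x) 0)
  have h4 := mul_nonneg hb (le_max_right (z - y) 0)
  refine max_le ?_ (add_nonneg h3 h4)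
  dsimp only
  have : z = a * z + b * z := by rw [← add_mul, hab, one_mul]
  linarith

lemma MemM.tendsto_callPot_atTop {μ : Measure ℝ} (hμ : MemM μ) :
    Tendsto (callPot μ) atTop (nhds 0) := by
  have := tendsto_integral_filter_of_dominated_convergence (μ := μ) (l := (atTop : Filter ℝ))
    (F := fun x y => max (y - x) 0) (f := fun _ => (0 : ℝ)) (fun y => |y|)
    (.of_forall fun x => (hμ.integrable_call x).aestronglyMeasurable) ?_ hμ.2.abs ?_
  · simpa using! this
  · filter_upwards [eventually_ge_atTop 0] with x hx
    refine .of_forall fun y => ?_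
    rw [Real.norm_of_nonneg (le_max_right _ _)]
    exact max_le (by linarith [le_abs_self y]) (abs_nonneg _)
  · refine .of_forall fun y => tendsto_const_nhds.congr' ?_
    filter_upwards [eventually_ge_atTop y] with x hx
    rw [max_eq_right (by linarith)]

lemma MemM.tendsto_callPot_atBot {μ : Measure ℝ} (hμ : MemM μ) :
    Tendsto (fun x => callPot μ x - ((∫ y, y ∂μ) - μ.real univ * x)) atBot (nhds 0) := by
  have := hμ.1
  have := tendsto_integral_filter_of_dominated_convergence (μ := μ) (l := (atBot : Filter ℝ))
    (F := fun x y => max (y - x) 0 - (y - x)) (f := fun _ => (0 : ℝ)) (fun y => |y|)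
    (.of_forall fun x => (by fun_prop : Continuous _).aestronglyMeasurable) ?_ hμ.2.abs ?_
  · have e : ∀ x, ∫ y, (max (y - x) 0 - (y - x)) ∂μ
        = callPot μ x - ((∫ y, y ∂μ) - μ.real univ * x) := by
      intro x
      rw [integral_sub (hμ.integrable_call x)
          (show Integrable (fun y => y - x) μ from hμ.2.sub (integrable_const x)),
        integral_sub hμ.2 (integrable_const x), integral_const, smul_eq_mul, callPot]
    simpa [e] using! this
  · filter_upwards [eventually_le_atBot 0] with x hx
    refine .of_forall fun y => ?_
    have := neg_abs_le y
    rcases le_total y x with h | h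
    · rw [max_eq_right (by linarith), Real.norm_of_nonneg (by linarith)]
      linarith
    · rw [max_eq_left (by linarith), sub_self, norm_zero]
      exact abs_nonneg _
  · refine .of_forall fun y => tendsto_const_nhds.congr' ?_
    filter_upwards [eventually_le_atBot y] with x hx
    rw [max_eq_left (by linarith), sub_self]

/-- The Stieltjes function `t ↦ -μ (t, ∞)`. -/
def tailStieltjes (μ : Measure ℝ) [IsFiniteMeasure μ] : StieltjesFunction ℝ where
  toFun t := -μ.real (Ioi t)
  mono' x y hxy := neg_le_neg (measureReal_mono (Ioi_subset_Ioi hxy))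
  right_continuous' x := by
    have e : ∀ t, -μ.real (Ioi t) = μ.real (Iic t) - μ.real univ := by
      intro t
      have := measureReal_add_measureReal_compl (μ := μ) (measurableSet_Iic (a := t))
      rw [compl_Iic] at this
      linarith
    simp only [e]
    rw [← continuousWithinAt_Ioi_iff_Ici]
    refine ContinuousWithinAt.sub ?_ continuousWithinAt_const
    have h := tendsto_measure_biInter_gt (μ := μ) (s := fun t : ℝ => Iic t) (a := x)
      (fun r _ => measurableSet_Iic.nullMeasurableSet) (fun i j _ hij => Iic_subset_Iic.2 hij)
      ⟨x + 1, by simp, measure_ne_top _ _⟩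
    have hI : ⋂ r, ⋂ (_ : r > x), Iic r = Iic x := by
      ext z
      simp only [mem_iInter, mem_Iic]
      exact ⟨fun h => le_of_forall_gt_imp_ge_of_dense h, fun h r hr => h.trans hr.le⟩
    rw [hI] at h
    exact (ENNReal.tendsto_toReal (measure_ne_top _ _)).comp h

lemma tailStieltjes_apply (μ : Measure ℝ) [IsFiniteMeasure μ] (t : ℝ) :
    tailStieltjes μ t = -μ.real (Ioi t) := rfl

lemma tailStieltjes_sub (μ : Measure ℝ) [IsFiniteMeasure μ] {x y : ℝ} (hxy : x ≤ y) :
    tailStieltjes μ y - tailStieltjes μ x = μ.real (Ioc x y) := by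
  rw [tailStieltjes_apply, tailStieltjes_apply]
  have : μ.real (Ioc x y ∪ Ioi y) = μ.real (Ioc x y) + μ.real (Ioi y) :=
    measureReal_union (by
      rw [Set.disjoint_left]; intro z hz hz'; exact absurd hz.2 (not_le.2 hz')) measurableSet_Ioi
  rw [Ioc_union_Ioi_eq_Ioi hxy] at this
  linarith

lemma tailStieltjes_measure (μ : Measure ℝ) [IsFiniteMeasure μ] :
    (tailStieltjes μ).measure = μ := by
  refine Measure.ext_of_Ioc _ _ fun x y hxy => ?_
  rw [StieltjesFunction.measure_Ioc, tailStieltjes_sub μ hxy.le, measureReal_def,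
    ENNReal.ofReal_toReal (measure_ne_top _ _)]

lemma integral_indicator_lt {x y : ℝ} (hxy : x ≤ y) (z : ℝ) :
    ∫ t in Ioc x y, (Iio z).indicator (fun _ => (1 : ℝ)) t = max (z - x) 0 - max (z - y) 0 := by
  rw [integral_indicator measurableSet_Iio, Measure.restrict_restrict measurableSet_Iio,
    setIntegral_const, smul_eq_mul, mul_one]
  rcases le_total z x with h | h
  · have : Iio z ∩ Ioc x y = ∅ := by
      ext t; simp only [mem_inter_iff, mem_Iio, mem_Ioc, mem_empty_iff_false]; grind
    rw [this, max_eq_right (by linarith), max_eq_right (by linarith)]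
    simp
  · rcases le_total z y with h' | h'
    · have : Iio z ∩ Ioc x y = Ioo x z := by
        ext t; simp only [mem_inter_iff, mem_Iio, mem_Ioc, mem_Ioo]; grind
      rw [this, max_eq_left (by linarith), max_eq_right (by linarith), Real.volume_real_Ioo_of_le h]
      simp
    · rcases h'.eq_or_lt with rfl | h'
      · have : Iio y ∩ Ioc x y = Ioo x y := by
          ext t; simp only [mem_inter_iff, mem_Iio, mem_Ioc, mem_Ioo]; grind
        rw [this, max_eq_left (by linarith), Real.volume_real_Ioo_of_le h]
        simp
      · have : Iio z ∩ Ioc x y = Ioc x y := by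
          ext t; simp only [mem_inter_iff, mem_Iio, mem_Ioc]; grind
        rw [this, max_eq_left (by linarith), max_eq_left (by linarith),
          Real.volume_real_Ioc_of_le hxy]
        ring

lemma MemM.integral_tailStieltjes {μ : Measure ℝ} [IsFiniteMeasure μ] (hμ : MemM μ) (x y : ℝ) :
    ∫ t in x..y, tailStieltjes μ t = callPot μ y - callPot μ x := by
  wlog hxy : x ≤ y generalizing x y
  · rw [intervalIntegral.integral_symm, this y x (le_of_not_ge hxy)]
    ring
  have hint : Integrable (Function.uncurry fun z t : ℝ => (Iio z).indicator (fun _ => (1 : ℝ)) t)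
      (μ.prod (volume.restrict (Ioc x y))) := by
    have e : (Function.uncurry fun z t : ℝ => (Iio z).indicator (fun _ => (1 : ℝ)) t)
        = {p : ℝ × ℝ | p.2 < p.1}.indicator fun _ => (1 : ℝ) := by
      ext ⟨z, t⟩; simp [Function.uncurry, indicator]
    rw [e]
    exact (integrable_const 1).indicator (measurableSet_lt measurable_snd measurable_fst)
  have hswap := integral_integral_swap hint
  simp only [integral_indicator_lt hxy] at hswap
  rw [integral_sub (hμ.integrable_call x) (hμ.integrable_call y)] at hswap
  have e : ∀ t, ∫ z, (Iio z).indicator (fun _ => (1 : ℝ)) t ∂μ = μ.real (Ioi t) := by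
    intro t
    have : (fun z => (Iio z).indicator (fun _ => (1 : ℝ)) t) = (Ioi t).indicator fun _ => 1 := by
      ext z; simp [indicator]
    rw [this, integral_indicator measurableSet_Ioi, setIntegral_const, smul_eq_mul, mul_one]
  simp only [e] at hswap
  rw [intervalIntegral.integral_of_le hxy]
  simp only [tailStieltjes_apply, integral_neg, ← hswap, callPot]
  ring

/-- The signed kernel of `∫ s in 0..z`. -/
def layerKernel (z t : ℝ) : ℝ :=
  (Ioo 0 z).indicator (fun _ => (1 : ℝ)) t - (Icc z 0).indicator (fun _ => (1 : ℝ)) t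

lemma integral_mul_layerKernel (s : ℝ → ℝ) (z : ℝ) :
    ∫ t, s t * layerKernel z t = ∫ t in (0 : ℝ)..z, s t := by
  rcases lt_or_ge 0 z with hz | hz
  · have e : ∀ t, s t * layerKernel z t = (Ioo 0 z).indicator s t := by
      intro t
      simp [layerKernel, Icc_eq_empty (not_le.2 hz), indicator]
    simp only [e]
    rw [integral_indicator measurableSet_Ioo, intervalIntegral.integral_of_le hz.le,
      integral_Ioc_eq_integral_Ioo]
  · have e : ∀ t, s t * layerKernel z t = (Icc z 0).indicator (fun t => -s t) t := by
      intro t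
      by_cases ht : t ∈ Icc z 0 <;> simp [layerKernel, Ioo_eq_empty (not_lt.2 hz), ht]
    simp only [e]
    rw [integral_indicator measurableSet_Icc, intervalIntegral.integral_of_ge hz,
      integral_Icc_eq_integral_Ioc, integral_neg]

lemma measurable_layerKernel : Measurable (Function.uncurry layerKernel) := by
  have e : Function.uncurry layerKernel = fun p : ℝ × ℝ =>
      {p : ℝ × ℝ | 0 < p.2 ∧ p.2 < p.1}.indicator (fun _ => (1 : ℝ)) p -
        {p : ℝ × ℝ | p.1 ≤ p.2 ∧ p.2 ≤ 0}.indicator (fun _ => (1 : ℝ)) p := by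
    ext ⟨z, t⟩
    simp [Function.uncurry, layerKernel, indicator]
  rw [e]
  refine (measurable_const.indicator ?_).sub (measurable_const.indicator ?_)
  · exact (measurableSet_lt measurable_const measurable_snd).inter
      (measurableSet_lt measurable_snd measurable_fst)
  · exact (measurableSet_le measurable_fst measurable_snd).inter
      (measurableSet_le measurable_snd measurable_const)

lemma integrable_layerKernel (z : ℝ) : Integrable (layerKernel z) := by
  refine Integrable.sub ?_ ?_
  · exact IntegrableOn.integrable_indicator (integrableOn_const (by simp)) measurableSet_Ioo
  · exact IntegrableOn.integrable_indicator (integrableOn_const (by simp)) measurableSet_Icc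

lemma integral_norm_layerKernel (z : ℝ) : ∫ t, ‖layerKernel z t‖ = |z| := by
  rcases lt_or_ge 0 z with hz | hz
  · have e : ∀ t, ‖layerKernel z t‖ = (Ioo 0 z).indicator (fun _ => (1 : ℝ)) t := by
      intro t
      by_cases ht : t ∈ Ioo 0 z <;> simp [layerKernel, Icc_eq_empty (not_le.2 hz), ht]
    simp only [e]
    rw [integral_indicator measurableSet_Ioo, setIntegral_const, Real.volume_real_Ioo_of_le hz.le,
      abs_of_pos hz]
    simp
  · have e : ∀ t, ‖layerKernel z t‖ = (Icc z 0).indicator (fun _ => (1 : ℝ)) t := by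
      intro t
      by_cases ht : t ∈ Icc z 0 <;> simp [layerKernel, Ioo_eq_empty (not_lt.2 hz), ht]
    simp only [e]
    rw [integral_indicator measurableSet_Icc, setIntegral_const, Real.volume_real_Icc_of_le hz,
      abs_of_nonpos hz]
    simp

lemma MemM.integrable_layerKernel {μ : Measure ℝ} [IsFiniteMeasure μ] (hμ : MemM μ) :
    Integrable (Function.uncurry layerKernel) (μ.prod volume) := by
  rw [integrable_prod_iff measurable_layerKernel.aestronglyMeasurable]
  refine ⟨.of_forall fun z => _root_.integrable_layerKernel z, ?_⟩
  simp only [Function.uncurry_apply_pair, integral_norm_layerKernel]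
  exact hμ.2.abs

/-- The tail function of `μ`, recentred at `0` so as to be integrable. -/
def tailKernel (μ : Measure ℝ) (t : ℝ) : ℝ := ∫ z, layerKernel z t ∂μ

lemma tailKernel_eq (μ : Measure ℝ) [IsFiniteMeasure μ] (t : ℝ) :
    tailKernel μ t = μ.real (Ioi t) - if 0 < t then 0 else μ.real univ := by
  rw [tailKernel]
  split_ifs with ht
  · have e : ∀ z, layerKernel z t = (Ioi t).indicator (fun _ => (1 : ℝ)) z := by
      intro z
      simp [layerKernel, indicator, ht, not_le.2 ht]
    simp only [e]
    rw [integral_indicator measurableSet_Ioi, setIntegral_const]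
    simp
  · have e : ∀ z, layerKernel z t = (Iic t).indicator (fun _ => (-1 : ℝ)) z := by
      intro z
      by_cases hz : z ≤ t <;> simp [layerKernel, indicator, ht, not_lt.1 ht, hz]
    simp only [e]
    rw [integral_indicator measurableSet_Iic, setIntegral_const]
    have := measureReal_add_measureReal_compl (μ := μ) (measurableSet_Iic (a := t))
    rw [compl_Iic] at this
    rw [smul_eq_mul]
    linarith

lemma MemM.integrable_tailKernel {μ : Measure ℝ} [IsFiniteMeasure μ] (hμ : MemM μ) :
    Integrable (tailKernel μ) :=
  hμ.integrable_layerKernel.integral_prod_right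

lemma MemM.integral_eq_tailKernel {μ : Measure ℝ} [IsFiniteMeasure μ] (hμ : MemM μ)
    {φ s : ℝ → ℝ} {L : ℝ} (hs : Measurable s) (hL : ∀ t, |s t| ≤ L)
    (h : ∀ z, ∫ t in (0 : ℝ)..z, s t = φ z - φ 0) :
    ∫ z, φ z ∂μ = μ.real univ * φ 0 + ∫ t, s t * tailKernel μ t := by
  have hint : Integrable (Function.uncurry fun z t => s t * layerKernel z t) (μ.prod volume) :=
    hμ.integrable_layerKernel.bdd_mul (f := fun p : ℝ × ℝ => s p.2)
      (hs.comp measurable_snd).aestronglyMeasurable (.of_forall fun p => hL p.2)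
  have hswap := integral_integral_swap hint
  have hleft := hint.integral_prod_left
  simp only [Function.uncurry_apply_pair, integral_mul_layerKernel, h] at hleft hswap
  have e : ∫ z, φ z ∂μ = ∫ z, ((φ z - φ 0) + φ 0) ∂μ := by simp
  rw [e, integral_add hleft (integrable_const _), hswap, integral_const, smul_eq_mul, add_comm]
  simp only [integral_const_mul, tailKernel]

/-- The difference of the tail functions of two measures. -/
def tailDiff (μ μ' : Measure ℝ) (t : ℝ) : ℝ := μ.real (Ioi t) - μ'.real (Ioi t)

lemma tailDiff_eq_tailKernel {μ μ' : Measure ℝ} [IsFiniteMeasure μ] [IsFiniteMeasure μ']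
    (hmass : μ.real univ = μ'.real univ) :
    tailDiff μ μ' = fun t => tailKernel μ t - tailKernel μ' t := by
  ext t
  rw [tailKernel_eq, tailKernel_eq, hmass, tailDiff]
  ring

lemma integrable_tailDiff {μ μ' : Measure ℝ} (hμ : MemM μ) (hμ' : MemM μ')
    (hmass : μ.real univ = μ'.real univ) : Integrable (tailDiff μ μ') := by
  have := hμ.1
  have := hμ'.1
  rw [tailDiff_eq_tailKernel hmass]
  exact hμ.integrable_tailKernel.sub hμ'.integrable_tailKernel

/-- Integration by parts against the difference of two measures of equal mass. -/
lemma integral_sub_eq_integral_tailDiff {μ μ' : Measure ℝ} (hμ : MemM μ) (hμ' : MemM μ')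
    (hmass : μ.real univ = μ'.real univ) {φ s : ℝ → ℝ} {L : ℝ} (hs : Measurable s)
    (hL : ∀ t, |s t| ≤ L) (h : ∀ z, ∫ t in (0 : ℝ)..z, s t = φ z - φ 0) :
    ∫ z, φ z ∂μ - ∫ z, φ z ∂μ' = ∫ t, s t * tailDiff μ μ' t := by
  have := hμ.1
  have := hμ'.1
  rw [hμ.integral_eq_tailKernel hs hL h, hμ'.integral_eq_tailKernel hs hL h, hmass,
    tailDiff_eq_tailKernel hmass]
  simp only [mul_sub]
  rw [integral_sub
    (hμ.integrable_tailKernel.bdd_mul hs.aestronglyMeasurable (.of_forall hL))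
    (hμ'.integrable_tailKernel.bdd_mul hs.aestronglyMeasurable (.of_forall hL))]
  ring

lemma integral_tailDiff {μ μ' : Measure ℝ} (hμ : MemM μ) (hμ' : MemM μ')
    (hmass : μ.real univ = μ'.real univ) :
    ∫ t, tailDiff μ μ' t = ∫ z, z ∂μ - ∫ z, z ∂μ' := by
  rw [integral_sub_eq_integral_tailDiff hμ hμ' hmass (φ := fun z => z) (s := fun _ => 1) (L := 1)
    measurable_const (by simp) (by simp)]
  simp

lemma integral_Ioi_tailDiff {μ μ' : Measure ℝ} (hμ : MemM μ) (hμ' : MemM μ')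
    (hmass : μ.real univ = μ'.real univ) (x : ℝ) :
    ∫ t in Ioi x, tailDiff μ μ' t = callPot μ x - callPot μ' x := by
  have := hμ.1
  have := hμ'.1
  have hint : IntegrableOn (tailDiff μ μ') (Ioi x) :=
    (integrable_tailDiff hμ hμ' hmass).integrableOn
  refine tendsto_nhds_unique (intervalIntegral_tendsto_integral_Ioi x hint tendsto_id) ?_
  have e : ∀ y, ∫ t in x..y, tailDiff μ μ' t
      = callPot μ x - callPot μ' x - (callPot μ y - callPot μ' y) := by
    intro y
    have e' : ∀ t, tailDiff μ μ' t = tailStieltjes μ' t - tailStieltjes μ t := by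
      intro t; rw [tailDiff, tailStieltjes_apply, tailStieltjes_apply]; ring
    simp only [e']
    rw [intervalIntegral.integral_sub (tailStieltjes μ').mono.intervalIntegrable
      (tailStieltjes μ).mono.intervalIntegrable, hμ.integral_tailStieltjes,
      hμ'.integral_tailStieltjes]
    ring
  simp only [id, e]
  simpa using! tendsto_const_nhds.sub (hμ.tendsto_callPot_atTop.sub hμ'.tendsto_callPot_atTop)

lemma leC.facts {μ η : Measure ℝ} (h : leC μ η) :
    μ.real univ = η.real univ ∧ ∫ z, z ∂μ = ∫ z, z ∂η ∧ ∀ x, callPot μ x ≤ callPot η x := by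
  have h1 := h (fun _ => 1) ⟨1, fun x => by simp⟩ (convexOn_const 1 convex_univ)
  have h2 := h (fun _ => -1) ⟨1, fun x => by simp⟩ (convexOn_const (-1) convex_univ)
  have h3 := h (fun x => x) ⟨1, fun x => by simp⟩ (convexOn_id convex_univ)
  have h4 := h (fun x => -x) ⟨1, fun x => by simp⟩ (concaveOn_id convex_univ).neg
  simp only [integral_const, smul_eq_mul] at h1 h2
  rw [MeasureTheory.integral_neg, MeasureTheory.integral_neg] at h4
  exact ⟨by linarith, by linarith, fun x => h _ (linGrowth_call x) (convexOn_call x)⟩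

lemma setIntegral_nonneg_of_isUpperSet {G : ℝ → ℝ} (h0 : 0 ≤ ∫ t, G t)
    (h : ∀ x, 0 ≤ ∫ t in Ioi x, G t) {S : Set ℝ} (hS : IsUpperSet S) : 0 ≤ ∫ t in S, G t := by
  rcases S.eq_empty_or_nonempty with rfl | hne
  · simp
  by_cases hb : BddBelow S
  · have hsub : Ioi (sInf S) ⊆ S := fun y hy => by
      obtain ⟨z, hz, hzy⟩ := (csInf_lt_iff hb hne).1 hy
      exact hS hzy.le hz
    have hsub' : S ⊆ Ici (sInf S) := fun y hy => csInf_le hb hy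
    have hae : S =ᵐ[volume] Ioi (sInf S) :=
      Filter.EventuallyLE.antisymm (hsub'.eventuallyLE.trans Ioi_ae_eq_Ici.symm.le)
        hsub.eventuallyLE
    rw [setIntegral_congr_set hae]
    exact h _
  · have : S = univ := by
      refine eq_univ_of_forall fun y => ?_
      rw [bddBelow_def] at hb
      push Not at hb
      obtain ⟨z, hz, hzy⟩ := hb y
      exact hS hzy.le hz
    rw [this, setIntegral_univ]
    exact h0

/-- Layer cake: a bounded monotone weight preserves nonnegativity of upper-tail integrals. -/
lemma integral_mul_nonneg_of_monotone {G r : ℝ → ℝ} (hG : Integrable G) (h0 : ∫ t, G t = 0)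
    (h : ∀ x, 0 ≤ ∫ t in Ioi x, G t) (hr : Monotone r) {L : ℝ} (hL : ∀ t, |r t| ≤ L) :
    0 ≤ ∫ t, r t * G t := by
  have hL0 : -L ≤ L := by linarith [(abs_nonneg _).trans (hL 0)]
  let F : ℝ → ℝ → ℝ := fun t u => {p : ℝ × ℝ | p.2 < r p.1}.indicator (fun p => G p.1) (t, u)
  have hint : Integrable (Function.uncurry F) (volume.prod (volume.restrict (Ioc (-L) L))) := by
    refine Integrable.indicator (f := fun p : ℝ × ℝ => G p.1) ?_
      (measurableSet_lt measurable_snd (hr.measurable.comp measurable_fst))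
    exact hG.comp_fst _
  have hswap := integral_integral_swap hint
  have hin : ∀ t, ∫ u in Ioc (-L) L, F t u = r t * G t + L * G t := by
    intro t
    have hb := abs_le.1 (hL t)
    have e : ∀ u, F t u = G t * (Iio (r t)).indicator (fun _ => (1 : ℝ)) u := by
      intro u
      simp [F, indicator]
    simp only [e]
    rw [integral_const_mul, integral_indicator_lt hL0, max_eq_left (by linarith),
      max_eq_right (by linarith)]
    ring
  have hout : ∀ u, 0 ≤ ∫ t, F t u := by
    intro u
    have e : ∀ t, F t u = {t | u < r t}.indicator G t := by
      intro t
      simp [F, indicator]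
    simp only [e]
    rw [integral_indicator (measurableSet_lt measurable_const hr.measurable)]
    exact setIntegral_nonneg_of_isUpperSet h0.ge h fun x y hxy hx => lt_of_lt_of_le hx (hr hxy)
  have hrG : Integrable fun t => r t * G t :=
    hG.bdd_mul hr.measurable.aestronglyMeasurable (.of_forall hL)
  simp only [hin] at hswap
  rw [integral_add hrG (hG.const_mul L), integral_const_mul, h0, mul_zero, add_zero] at hswap
  rw [hswap]
  exact integral_nonneg hout

/-- Characterisation of the convex order by call potentials. -/
lemma leC_of_callPot_le {μ η : Measure ℝ} (hμ : MemM μ) (hη : MemM η)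
    (hmass : μ.real univ = η.real univ) (hmean : ∫ z, z ∂μ = ∫ z, z ∂η)
    (h : ∀ x, callPot μ x ≤ callPot η x) : leC μ η := by
  intro φ hφ hconv
  obtain ⟨r, hr⟩ := hconv.exists_stieltjes_slope
  obtain ⟨L, hL⟩ := slope_bounded_of_linGrowth r.mono hφ hr
  have e := integral_sub_eq_integral_tailDiff hη hμ hmass.symm r.mono.measurable hL fun z => hr 0 z
  have := integral_mul_nonneg_of_monotone (integrable_tailDiff hη hμ hmass.symm)
    (by rw [integral_tailDiff hη hμ hmass.symm]; linarith)
    (fun x => by rw [integral_Ioi_tailDiff hη hμ hmass.symm]; linarith [h x]) r.mono hL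
  linarith

lemma MemM.mono {ν η : Measure ℝ} (hν : MemM ν) (h : η ≤ ν) : MemM η :=
  have := hν.1
  ⟨isFiniteMeasure_of_le ν h, hν.2.mono_measure h⟩

lemma convexOn_callPot_sub {ν η : Measure ℝ} (hν : MemM ν) (h : η ≤ ν) :
    ConvexOn ℝ univ fun x => callPot ν x - callPot η x := by
  have hη := hν.mono h
  have := hη.1
  have hd : MemM (ν - η) := hν.mono Measure.sub_le
  have e : ∀ x, callPot ν x - callPot η x = callPot (ν - η) x := by
    intro x
    have h1 : callPot ν x = callPot (ν - η + η) x := by rw [Measure.sub_add_cancel_of_le h]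
    rw [h1, callPot, integral_add_measure (hd.integrable_call x) (hη.integrable_call x), callPot,
      callPot]
    ring
  simp only [e]
  exact hd.convexOn_callPot

lemma affine_eq_zero_of_tendsto {l : Filter ℝ} [l.NeBot] {c d : ℝ}
    (hl : Tendsto (fun x : ℝ => x + 1) l l)
    (h : Tendsto (fun x : ℝ => c * x + d) l (nhds 0)) : c = 0 ∧ d = 0 := by
  have h1 := (h.comp hl).sub h
  have e : ∀ x : ℝ, ((fun x : ℝ => c * x + d) ∘ fun x => x + 1) x - (c * x + d) = c := by
    intro x; simp only [Function.comp_apply]; ring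
  simp only [e, sub_zero] at h1
  obtain rfl := tendsto_nhds_unique tendsto_const_nhds h1
  simp only [zero_mul, zero_add] at h
  exact ⟨rfl, tendsto_nhds_unique tendsto_const_nhds h⟩

/-- A convex function `v` lying between two call potentials of equal mass and barycentre such that
`callPot ν - v` is convex is itself the call potential of a measure dominated by `ν`. -/
lemma exists_measure_callPot_eq {μ η ν : Measure ℝ} (hμ : MemM μ) (hη : MemM η) (hν : MemM ν)
    (hmass : μ.real univ = η.real univ) (hmean : ∫ z, z ∂μ = ∫ z, z ∂η) {v : ℝ → ℝ}
    (hv : ConvexOn ℝ univ v) (hvν : ConvexOn ℝ univ fun x => callPot ν x - v x)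
    (h1 : ∀ x, callPot μ x ≤ v x) (h2 : ∀ x, v x ≤ callPot η x) :
    ∃ θ : Measure ℝ, θ ≤ ν ∧ leC μ θ ∧ callPot θ = v := by
  have := hν.1
  obtain ⟨r, hr⟩ := hv.exists_stieltjes_slope
  obtain ⟨κ, hκ⟩ := hvν.exists_stieltjes_slope
  have hadd : r + κ = tailStieltjes ν := by
    have hint : ∀ x y, ∫ t in x..y, (r t + κ t - tailStieltjes ν t) = 0 := by
      intro x y
      rw [intervalIntegral.integral_sub
        (r.mono.intervalIntegrable.add κ.mono.intervalIntegrable)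
        (tailStieltjes ν).mono.intervalIntegrable,
        intervalIntegral.integral_add r.mono.intervalIntegrable κ.mono.intervalIntegrable, hr, hκ,
        hν.integral_tailStieltjes]
      ring
    have hI : ∀ x y, IntervalIntegrable (fun t => r t + κ t - tailStieltjes ν t) volume x y :=
      fun x y => (r.mono.intervalIntegrable.add κ.mono.intervalIntegrable).sub
        (tailStieltjes ν).mono.intervalIntegrable
    have hC : ∀ x, ContinuousWithinAt (fun t => r t + κ t - tailStieltjes ν t) (Ici x) x :=
      fun x => ((r.right_continuous x).add (κ.right_continuous x)).sub
        ((tailStieltjes ν).right_continuous x)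
    ext x
    have p1 := nonneg_of_intervalIntegral_nonneg hC hI (fun x y _ => (hint x y).ge) x
    have p2 := nonneg_of_intervalIntegral_nonneg (fun x => (hC x).neg) (fun x y => (hI x y).neg)
      (fun x y _ => by
         simp only [Pi.neg_apply, intervalIntegral.integral_neg, hint, neg_zero, le_refl]) x
    rw [StieltjesFunction.add_apply]
    simp only [Pi.neg_apply] at p2
    linarith
  have hle : r.measure ≤ ν := by
    rw [← tailStieltjes_measure ν, ← hadd, StieltjesFunction.measure_add]
    exact Measure.le_add_right le_rfl
  have hθ : MemM r.measure := hν.mono hle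
  have := hθ.1
  have hconst : ∀ x, r x = tailStieltjes r.measure x + (r 0 - tailStieltjes r.measure 0) := by
    have key : ∀ x y, x ≤ y → r y - r x
        = tailStieltjes r.measure y - tailStieltjes r.measure x := by
      intro x y hxy
      rw [tailStieltjes_sub _ hxy, measureReal_def, StieltjesFunction.measure_Ioc,
        ENNReal.toReal_ofReal (sub_nonneg.2 (r.mono hxy))]
    intro x
    rcases le_total 0 x with h | h
    · linarith [key 0 x h]
    · linarith [key x 0 h]
  obtain ⟨c, hc⟩ : ∃ c, c = r 0 - tailStieltjes r.measure 0 := ⟨_, rfl⟩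
  rw [← hc] at hconst
  have haff : ∀ x, v x - callPot r.measure x = c * x + (v 0 - callPot r.measure 0) := by
    intro x
    have e1 := hr 0 x
    rw [intervalIntegral.integral_congr (g := fun t => tailStieltjes r.measure t + c)
      (fun t _ => hconst t), intervalIntegral.integral_add
      (tailStieltjes r.measure).mono.intervalIntegrable (by simp), hθ.integral_tailStieltjes,
      intervalIntegral.integral_const, smul_eq_mul] at e1
    linarith
  obtain ⟨d, hd⟩ : ∃ d, d = v 0 - callPot r.measure 0 := ⟨_, rfl⟩
  rw [← hd] at haff
  have hv0 : Tendsto v atTop (nhds 0) :=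
    tendsto_of_tendsto_of_tendsto_of_le_of_le hμ.tendsto_callPot_atTop hη.tendsto_callPot_atTop
      h1 h2
  have hlim := hv0.sub hθ.tendsto_callPot_atTop
  simp only [haff, sub_zero] at hlim
  obtain ⟨hc0, hd0⟩ := affine_eq_zero_of_tendsto (tendsto_atTop_add_const_right _ 1 tendsto_id) hlim
  have hvθ : callPot r.measure = v := by
    ext x
    have := haff x
    rw [hc0, hd0] at this
    linarith
  subst hvθ
  have hbot : Tendsto (fun x => callPot r.measure x - callPot μ x) atBot (nhds 0) := by
    have hup : Tendsto (fun x => callPot η x - callPot μ x) atBot (nhds 0) := by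
      have := hη.tendsto_callPot_atBot.sub hμ.tendsto_callPot_atBot
      simpa [hmass, hmean] using this
    exact tendsto_of_tendsto_of_tendsto_of_le_of_le tendsto_const_nhds hup
      (fun x => sub_nonneg.2 (h1 x)) (fun x => sub_le_sub_right (h2 x) _)
  have hbot' := hbot.sub (hθ.tendsto_callPot_atBot.sub hμ.tendsto_callPot_atBot)
  have e : ∀ x, callPot r.measure x - callPot μ x -
      (callPot r.measure x - ((∫ y, y ∂r.measure) - r.measure.real univ * x) -
        (callPot μ x - ((∫ y, y ∂μ) - μ.real univ * x)))
      = (μ.real univ - r.measure.real univ) * x + ((∫ y, y ∂r.measure) - ∫ y, y ∂μ) := by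
    intro x; ring
  simp only [e, sub_zero] at hbot'
  obtain ⟨hm, hb⟩ := affine_eq_zero_of_tendsto
    (tendsto_atBot_add_const_right _ 1 tendsto_id) hbot'
  exact ⟨r.measure, hle, leC_of_callPot_le hμ hθ (by linarith) (by linarith) h1, rfl⟩

/-- In terms of call potentials, the shadow is given by the greatest convex minorant. -/
lemma IsShadow.isGCM {μ ν η : Measure ℝ} (hμ : MemM μ) (hν : MemM ν) (h : IsShadow μ ν η) :
    IsGCM (fun x => callPot ν x - callPot μ x) (fun x => callPot ν x - callPot η x) := by
  obtain ⟨hle, hην, hmin⟩ := h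
  have hη := hν.mono hην
  obtain ⟨hmass, hmean, hcall⟩ := hle.facts
  have hk₀ := convexOn_callPot_sub hν hην
  have hk₀le : ∀ x, callPot ν x - callPot η x ≤ callPot ν x - callPot μ x :=
    fun x => sub_le_sub_left (hcall x) _
  obtain ⟨k, hk⟩ := exists_isGCM hk₀ hk₀le
  refine ⟨hk₀, hk₀le, fun j hj hjle x => (hk.2.2 j hj hjle x).trans ?_⟩
  have hv := hk.convexOn_sub hν.convexOn_callPot hμ.convexOn_callPot
  obtain ⟨θ, hθν, hμθ, hθ⟩ := exists_measure_callPot_eq hμ hη hν hmass hmean hv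
    (by simpa using! hk.1) (fun x => by have := hk.2.1 x; dsimp only at this; linarith)
    (fun x => by have := hk.2.2 _ hk₀ hk₀le x; linarith)
  have := (hmin θ hμθ hθν).facts.2.2 x
  rw [hθ] at this
  linarith

lemma IsGCM.slope_le {f h kf kh rf rh : ℝ → ℝ} {P : ℝ} (hf : IsGCM f kf) (hh : IsGCM h kh)
    (hmono : Monotone fun x => h x - f x) (hle : ∀ x, h x ≤ f x) (hge : ∀ x, f x - P ≤ h x)
    (cf : ∀ x, ContinuousWithinAt rf (Ici x) x) (ch : ∀ x, ContinuousWithinAt rh (Ici x) x)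
    (If : ∀ x y, IntervalIntegrable rf volume x y) (Ih : ∀ x y, IntervalIntegrable rh volume x y)
    (sf : ∀ x y, ∫ t in x..y, rf t = kf y - kf x) (sh : ∀ x y, ∫ t in x..y, rh t = kh y - kh x) :
    (∀ t, rf t ≤ rh t) ∧ ∀ x y, ∫ t in x..y, (rh t - rf t) ≤ P := by
  have hsub : ∀ x y, ∫ t in x..y, (rh t - rf t) = (kh y - kf y) - (kh x - kf x) := by
    intro x y
    rw [intervalIntegral.integral_sub (Ih x y) (If x y), sf, sh]
    ring
  have hm := hf.monotone_sub hh hmono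
  refine ⟨fun t => sub_nonneg.1 (nonneg_of_intervalIntegral_nonneg (r := fun t => rh t - rf t)
    (fun x => (ch x).sub (cf x)) (fun x y => (Ih x y).sub (If x y)) (fun x y hxy => ?_) t),
    fun x y => ?_⟩
  · rw [hsub]
    exact sub_nonneg.2 (hm hxy)
  · rw [hsub]
    have h1 := hf.2.2 kh hh.1 (fun x => (hh.2.1 x).trans (hle x)) y
    have h2 := hh.2.2 _ (hf.1.add_const (-P)) (fun x => by
      have := hf.2.1 x
      have := hge x
      simp only [Pi.add_apply]
      linarith) x
    simp only [Pi.add_apply] at h2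
    linarith

lemma monotone_neg_integral_Ioi {g : ℝ → ℝ} (hg : Integrable g) (h0 : ∀ t, 0 ≤ g t) :
    Monotone fun x => -∫ t in Ioi x, g t := fun _ _ hxy =>
  neg_le_neg (setIntegral_mono_set hg.integrableOn (.of_forall h0)
    (Ioi_subset_Ioi hxy).eventuallyLE)

/-- The shadow projection contracts the `L¹` distance of tail functions. -/
lemma integral_abs_tailDiff_shadow_le {μ μ' ν η η' : Measure ℝ} (hμ : MemM μ) (hμ' : MemM μ')
    (hν : MemM ν) (hmass : μ.real univ = μ'.real univ) (hη : IsShadow μ ν η)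
    (hη' : IsShadow μ' ν η') :
    ∫ t, |tailDiff η η' t| ≤ ∫ t, |tailDiff μ μ' t| := by
  have hmη := hν.mono hη.2.1
  have hmη' := hν.mono hη'.2.1
  have hmassη : η.real univ = η'.real univ := by
    rw [← hη.1.facts.1, ← hη'.1.facts.1, hmass]
  have := hν.1
  have := hmη.1
  have := hmη'.1
  have hG := integrable_tailDiff hμ hμ' hmass
  have hE := integrable_tailDiff hmη hmη' hmassη
  have gf := hη.isGCM hμ hν
  have gg := hη'.isGCM hμ' hν
  have hp := hG.neg.pos_part
  have hq := hG.pos_part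
  have hp0 : ∀ t, 0 ≤ max ((-tailDiff μ μ') t) 0 := fun t => le_max_right _ _
  have hq0 : ∀ t, 0 ≤ max (tailDiff μ μ' t) 0 := fun t => le_max_right _ _
  let h : ℝ → ℝ := fun x =>
    callPot ν x - callPot μ x + -∫ t in Ioi x, max ((-tailDiff μ μ') t) 0
  have hh : ∀ x, h x = callPot ν x - callPot μ' x + -∫ t in Ioi x, max (tailDiff μ μ' t) 0 := by
    intro x
    have e1 := integral_Ioi_tailDiff hμ hμ' hmass x
    have e2 : ∫ t in Ioi x, tailDiff μ μ' t = (∫ t in Ioi x, max (tailDiff μ μ' t) 0) -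
        ∫ t in Ioi x, max ((-tailDiff μ μ') t) 0 := by
      rw [← integral_sub hq.integrableOn hp.integrableOn]
      refine integral_congr_ae (.of_forall fun t => ?_)
      simp only [Pi.neg_apply]
      rcases le_total 0 (tailDiff μ μ' t) with h | h
      · rw [max_eq_left h, max_eq_right (by linarith), sub_zero]
      · rw [max_eq_right h, max_eq_left (by linarith)]; ring
    simp only [h]
    linarith
  have bp : ∀ x, 0 ≤ ∫ t in Ioi x, max ((-tailDiff μ μ') t) 0 := fun x => integral_nonneg hp0
  have bq : ∀ x, 0 ≤ ∫ t in Ioi x, max (tailDiff μ μ' t) 0 := fun x => integral_nonneg hq0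
  have bp' : ∀ x, ∫ t in Ioi x, max ((-tailDiff μ μ') t) 0 ≤ ∫ t, max ((-tailDiff μ μ') t) 0 :=
    fun x => setIntegral_le_integral hp (.of_forall hp0)
  have bq' : ∀ x, ∫ t in Ioi x, max (tailDiff μ μ' t) 0 ≤ ∫ t, max (tailDiff μ μ' t) 0 :=
    fun x => setIntegral_le_integral hq (.of_forall hq0)
  obtain ⟨k, gh⟩ : ∃ k, IsGCM h k := by
    refine exists_isGCM (gf.1.add_const (-∫ t, max ((-tailDiff μ μ') t) 0)) fun x => ?_
    have := gf.2.1 x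
    simp only [Pi.add_apply, h] at this ⊢
    linarith [bp' x]
  obtain ⟨r, hr⟩ := gh.1.exists_stieltjes_slope
  have slope : ∀ {θ : Measure ℝ} [IsFiniteMeasure θ], MemM θ → ∀ x y,
      ∫ t in x..y, (tailStieltjes ν t - tailStieltjes θ t)
        = (callPot ν y - callPot θ y) - (callPot ν x - callPot θ x) := by
    intro θ _ hθ x y
    rw [intervalIntegral.integral_sub (tailStieltjes ν).mono.intervalIntegrable
      (tailStieltjes θ).mono.intervalIntegrable, hν.integral_tailStieltjes,
      hθ.integral_tailStieltjes]
    ring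
  have cont : ∀ (θ : Measure ℝ) [IsFiniteMeasure θ] (x : ℝ), ContinuousWithinAt
      (fun t => tailStieltjes ν t - tailStieltjes θ t) (Ici x) x := fun θ _ x =>
    ((tailStieltjes ν).right_continuous x).sub ((tailStieltjes θ).right_continuous x)
  have integ : ∀ (θ : Measure ℝ) [IsFiniteMeasure θ] (x y : ℝ), IntervalIntegrable
      (fun t => tailStieltjes ν t - tailStieltjes θ t) volume x y := fun θ _ x y =>
    (tailStieltjes ν).mono.intervalIntegrable.sub (tailStieltjes θ).mono.intervalIntegrable
  obtain ⟨u0, uP⟩ := gf.slope_le (P := ∫ t, max ((-tailDiff μ μ') t) 0) gh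
    (by simpa [h] using! monotone_neg_integral_Ioi hp hp0)
    (fun x => by simp only [h]; linarith [bp x]) (fun x => by simp only [h]; linarith [bp' x])
    (cont η) r.right_continuous (integ η) (fun x y => r.mono.intervalIntegrable) (slope hmη) hr
  obtain ⟨w0, wQ⟩ := gg.slope_le (P := ∫ t, max (tailDiff μ μ' t) 0) gh
    (by simpa [hh] using! monotone_neg_integral_Ioi hq hq0)
    (fun x => by rw [hh]; linarith [bq x]) (fun x => by rw [hh]; linarith [bq' x])
    (cont η') r.right_continuous (integ η') (fun x y => r.mono.intervalIntegrable) (slope hmη') hr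
  have hsum : ∫ t, |tailDiff μ μ' t|
      = (∫ t, max ((-tailDiff μ μ') t) 0) + ∫ t, max (tailDiff μ μ' t) 0 := by
    rw [← integral_add hp hq]
    refine integral_congr_ae (.of_forall fun t => ?_)
    simp only [Pi.neg_apply]
    rcases le_total 0 (tailDiff μ μ' t) with h | h
    · rw [max_eq_left h, max_eq_right (by linarith), abs_of_nonneg h, zero_add]
    · rw [max_eq_right h, max_eq_left (by linarith), abs_of_nonpos h, add_zero]
  have hlim := intervalIntegral_tendsto_integral hE.abs tendsto_neg_atTop_atBot
    (tendsto_id (α := ℝ) (x := atTop))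
  refine le_of_tendsto hlim ?_
  filter_upwards [eventually_ge_atTop 0] with n hn
  simp only [id]
  have I1 := r.mono.intervalIntegrable.sub (integ η (-n) n)
  have I2 := r.mono.intervalIntegrable.sub (integ η' (-n) n)
  calc ∫ t in (-n)..n, |tailDiff η η' t|
      ≤ ∫ t in (-n)..n, ((r t - (tailStieltjes ν t - tailStieltjes η t)) +
          (r t - (tailStieltjes ν t - tailStieltjes η' t))) := by
        refine intervalIntegral.integral_mono_on (by linarith) hE.abs.intervalIntegrable
          (I1.add I2) fun t _ => ?_
        have e : tailDiff η η' t = (r t - (tailStieltjes ν t - tailStieltjes η' t)) -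
            (r t - (tailStieltjes ν t - tailStieltjes η t)) := by
          rw [tailDiff, tailStieltjes_apply η, tailStieltjes_apply η']; ring
        have := u0 t
        have := w0 t
        rw [e, abs_le]
        constructor <;> linarith
    _ ≤ ∫ t, |tailDiff μ μ' t| := by
        rw [intervalIntegral.integral_add I1 I2, hsum]
        exact add_le_add (uP _ _) (wQ _ _)

lemma abs_integral_sub_le_integral_tailDiff {μ μ' : Measure ℝ} (hμ : MemM μ) (hμ' : MemM μ')
    (hmass : μ.real univ = μ'.real univ) {f : ℝ → ℝ} (hf : LipschitzWith 1 f) :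
    |∫ x, f x ∂μ - ∫ x, f x ∂μ'| ≤ ∫ t, |tailDiff μ μ' t| := by
  have hb : ∀ t, |deriv f t| ≤ 1 := fun t => by simpa using norm_deriv_le_of_lipschitz hf
  rw [integral_sub_eq_integral_tailDiff hμ hμ' hmass (measurable_deriv f) hb
    fun z => (hf.lipschitzOnWith.absolutelyContinuousOnInterval).integral_deriv_eq_sub]
  refine (abs_integral_le_integral_abs).trans ?_
  refine integral_mono_of_nonneg (.of_forall fun t => abs_nonneg _)
    (integrable_tailDiff hμ hμ' hmass).abs (.of_forall fun t => ?_)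
  dsimp only
  rw [abs_mul]
  exact mul_le_of_le_one_left (abs_nonneg _) (hb t)

lemma exists_lipschitz_integral_sub_eq {μ μ' : Measure ℝ} (hμ : MemM μ) (hμ' : MemM μ')
    (hmass : μ.real univ = μ'.real univ) :
    ∃ f : ℝ → ℝ, LipschitzWith 1 f ∧
      ∫ x, f x ∂μ - ∫ x, f x ∂μ' = ∫ t, |tailDiff μ μ' t| := by
  have := hμ.1
  have := hμ'.1
  have hGm : Measurable (tailDiff μ μ') := by
    have e : tailDiff μ μ' = fun t => tailStieltjes μ' t - tailStieltjes μ t := by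
      ext t; rw [tailDiff, tailStieltjes_apply, tailStieltjes_apply]; ring
    rw [e]
    exact (tailStieltjes μ').mono.measurable.sub (tailStieltjes μ).mono.measurable
  let s : ℝ → ℝ := fun t => if 0 ≤ tailDiff μ μ' t then 1 else -1
  have hs : Measurable s :=
    Measurable.ite (measurableSet_le measurable_const hGm) measurable_const measurable_const
  have hb : ∀ t, |s t| ≤ 1 := fun t => by
    simp only [s]
    split_ifs <;> simp
  have hI : ∀ x y, IntervalIntegrable s volume x y := fun x y =>
    (intervalIntegrable_const (c := (1 : ℝ))).mono_fun hs.aestronglyMeasurable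
      (.of_forall fun t => by simpa using hb t)
  refine ⟨fun z => ∫ t in (0 : ℝ)..z, s t, ?_, ?_⟩
  · refine LipschitzWith.of_dist_le_mul fun x y => ?_
    rw [Real.dist_eq, Real.dist_eq, intervalIntegral.integral_interval_sub_left (hI _ _) (hI _ _)]
    have := intervalIntegral.norm_integral_le_of_norm_le_const (a := y) (b := x) (f := s) (C := 1)
      fun t _ => hb t
    simpa using this
  · rw [integral_sub_eq_integral_tailDiff hμ hμ' hmass hs hb (fun z => by simp)]
    refine integral_congr_ae (.of_forall fun t => ?_)
    simp only [s]
    split_ifs with h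
    · rw [abs_of_nonneg h, one_mul]
    · rw [abs_of_neg (not_le.1 h), neg_one_mul]

/-- the shadow projection is 1-Lipschitz in its first argument. -/
theorem shadow_lipschitz_source (μ μ' ν : Measure ℝ) (hμ : MemM μ) (hμ' : MemM μ')
    (hν : MemM ν) (hmass : μ Set.univ = μ' Set.univ)
    (h₁ : leCP μ ν) (h₂ : leCP μ' ν)
    (η η' : Measure ℝ) (hη : IsShadow μ ν η) (hη' : IsShadow μ' ν η') :
    W η η' ≤ W μ μ' := by
  have hm : μ.real univ = μ'.real univ := by rw [measureReal_def, measureReal_def, hmass]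
  have hmη : η.real univ = η'.real univ := by rw [← hη.1.facts.1, ← hη'.1.facts.1, hm]
  obtain ⟨g, hg, hgeq⟩ := exists_lipschitz_integral_sub_eq hμ hμ' hm
  have hbdd : BddAbove {d : ℝ | ∃ f : ℝ → ℝ, LipschitzWith 1 f ∧
      d = |∫ x, f x ∂μ - ∫ x, f x ∂μ'|} := by
    refine ⟨∫ t, |tailDiff μ μ' t|, ?_⟩
    rintro _ ⟨f, hf, rfl⟩
    exact abs_integral_sub_le_integral_tailDiff hμ hμ' hm hf
  refine csSup_le ⟨_, g, hg, rfl⟩ ?_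
  rintro _ ⟨f, hf, rfl⟩
  calc |∫ x, f x ∂η - ∫ x, f x ∂η'|
      ≤ ∫ t, |tailDiff η η' t| :=
        abs_integral_sub_le_integral_tailDiff (hν.mono hη.2.1) (hν.mono hη'.2.1) hmη hf
    _ ≤ ∫ t, |tailDiff μ μ' t| := integral_abs_tailDiff_shadow_le hμ hμ' hν hm hη hη'
    _ ≤ |∫ x, g x ∂μ - ∫ x, g x ∂μ'| := by rw [hgeq]; exact le_abs_self _
    _ ≤ W μ μ' := le_csSup hbdd ⟨g, hg, rfl⟩

end
end
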